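/- arXiv:2312.16111 — 2 statements merged into one kernel-verified Lean document; each statement's English description precedes it below -/
import Mathlib

section
/- Let Ω^j be a sequence of domains in ℂⁿ converging to a domain Ω_∞ ⊂ ℂⁿ in the local Hausdorff sense, such that K_{Ω^j}(z,z) > 0 on Ω^j and K_{Ω_∞}(z,z) > 0 on Ω_∞, K_{Ω^j}(z,z) → K_{Ω_∞}(z,z) for every z ∈ Ω_∞, and the Bergman metric b_{Ω_∞} is positive definite. Then b_{Ω^j}(z,ξ) → b_{Ω_∞}(z,ξ) as j → ∞, uniformly on compact subsets of Ω_∞ × ℂⁿ. -/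
open MeasureTheory Metric Filter Topology Set
open scoped ENNReal

noncomputable section

/-- Membership in the Bergman space `A²(Ω)`: holomorphic and square-integrable. -/
def MemA2 {n : ℕ} (Ω : Set (Fin n → ℂ)) (f : (Fin n → ℂ) → ℂ) : Prop :=
  DifferentiableOn ℂ f Ω ∧ MemLp f 2 (volume.restrict Ω)

/-- `K` is the Bergman kernel of `Ω`: the reproducing kernel of `A²(Ω)`. -/
def IsBergmanKernel {n : ℕ} (Ω : Set (Fin n → ℂ)) (K : (Fin n → ℂ) → (Fin n → ℂ) → ℂ) : Prop :=
  (∀ w ∈ Ω, MemA2 Ω fun z => K z w) ∧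
  ∀ f, MemA2 Ω f → ∀ w ∈ Ω, f w = ∫ z in Ω, f z * (starRingEnd ℂ) (K z w)

/-- Wirtinger derivative `∂f/∂z_μ`. -/
def wderiv {n : ℕ} (μ : Fin n) (f : (Fin n → ℂ) → ℂ) (z : Fin n → ℂ) : ℂ :=
  (fderiv ℝ f z (Pi.single μ 1) - Complex.I * fderiv ℝ f z (Pi.single μ Complex.I)) / 2

/-- Wirtinger derivative `∂f/∂z̄_μ`. -/
def wderivBar {n : ℕ} (μ : Fin n) (f : (Fin n → ℂ) → ℂ) (z : Fin n → ℂ) : ℂ :=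
  (fderiv ℝ f z (Pi.single μ 1) + Complex.I * fderiv ℝ f z (Pi.single μ Complex.I)) / 2

/-- One-variable Wirtinger derivative `∂f/∂z`. -/
def wderiv1 (f : ℂ → ℂ) (z : ℂ) : ℂ :=
  (fderiv ℝ f z 1 - Complex.I * fderiv ℝ f z Complex.I) / 2

/-- One-variable Wirtinger derivative `∂f/∂z̄`. -/
def wderiv1Bar (f : ℂ → ℂ) (z : ℂ) : ℂ :=
  (fderiv ℝ f z 1 + Complex.I * fderiv ℝ f z Complex.I) / 2

/-- Bergman metric tensor `g_{μν}(z) = ∂² log K(z,z) / ∂z_μ ∂z̄_ν`. -/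
def bergmanTensor {n : ℕ} (K : (Fin n → ℂ) → (Fin n → ℂ) → ℂ) (μ ν : Fin n)
    (z : Fin n → ℂ) : ℂ :=
  wderiv μ (fun w => wderivBar ν (fun u => Complex.log (K u u)) w) z

/-- The hermitian quadratic form of the Bergman metric. -/
def bergmanQuad {n : ℕ} (K : (Fin n → ℂ) → (Fin n → ℂ) → ℂ) (z ξ : Fin n → ℂ) : ℝ :=
  (∑ μ, ∑ ν, bergmanTensor K μ ν z * ξ μ * (starRingEnd ℂ) (ξ ν)).re

/-- The Bergman metric `b_Ω(z,ξ)`. -/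
def bergmanMetric {n : ℕ} (K : (Fin n → ℂ) → (Fin n → ℂ) → ℂ) (z ξ : Fin n → ℂ) : ℝ :=
  Real.sqrt (bergmanQuad K z ξ)

/-- Piecewise-`C¹` curves on `[0,1]`. -/
def PiecewiseC1 {n : ℕ} (γ : ℝ → (Fin n → ℂ)) : Prop :=
  ContinuousOn γ (Set.Icc 0 1) ∧
  ∃ (k : ℕ) (t : Fin (k + 1) → ℝ), StrictMono t ∧ t 0 = 0 ∧ t (Fin.last k) = 1 ∧
    ∀ i : Fin k, ContDiffOn ℝ 1 γ (Set.Icc (t i.castSucc) (t i.succ))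

/-- The Bergman length of a curve. -/
def bergmanLength {n : ℕ} (K : (Fin n → ℂ) → (Fin n → ℂ) → ℂ) (γ : ℝ → (Fin n → ℂ)) : ℝ :=
  ∫ t in (0:ℝ)..1, bergmanMetric K (γ t) (deriv γ t)

/-- The Bergman pseudodistance of `Ω`. -/
def bergmanDist {n : ℕ} (Ω : Set (Fin n → ℂ)) (K : (Fin n → ℂ) → (Fin n → ℂ) → ℂ)
    (z w : Fin n → ℂ) : ℝ :=
  sInf { L : ℝ | ∃ γ : ℝ → (Fin n → ℂ), γ 0 = z ∧ γ 1 = w ∧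
    (∀ t ∈ Set.Icc (0:ℝ) 1, γ t ∈ Ω) ∧ PiecewiseC1 γ ∧ L = bergmanLength K γ }

/-- The Bergman ball `B_Ω(p,r)`. -/
def bergmanBall {n : ℕ} (Ω : Set (Fin n → ℂ)) (K : (Fin n → ℂ) → (Fin n → ℂ) → ℂ)
    (p : Fin n → ℂ) (r : ℝ) : Set (Fin n → ℂ) :=
  { z ∈ Ω | bergmanDist Ω K p z < r }

/-- The Bergman pseudodistance is an honest distance. -/
def BergmanDistIsDistance {n : ℕ} (Ω : Set (Fin n → ℂ))
    (K : (Fin n → ℂ) → (Fin n → ℂ) → ℂ) : Prop :=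
  ∀ z ∈ Ω, ∀ w ∈ Ω, z ≠ w → 0 < bergmanDist Ω K z w

/-- `Ω` is complete with respect to the Bergman distance. -/
def BergmanComplete {n : ℕ} (Ω : Set (Fin n → ℂ))
    (K : (Fin n → ℂ) → (Fin n → ℂ) → ℂ) : Prop :=
  ∀ x : ℕ → (Fin n → ℂ), (∀ k, x k ∈ Ω) →
    (∀ ε : ℝ, 0 < ε → ∃ N, ∀ k ≥ N, ∀ l ≥ N, bergmanDist Ω K (x k) (x l) < ε) →
    ∃ p ∈ Ω, Filter.Tendsto (fun k => bergmanDist Ω K (x k) p) Filter.atTop (nhds 0)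

/-- The Euclidean unit ball `𝔹ⁿ ⊂ ℂⁿ`. -/
def euclUnitBall (n : ℕ) : Set (Fin n → ℂ) :=
  { z | ∑ μ, ‖z μ‖ ^ 2 < 1 }

/-- The Bergman–Fridman invariant `h_X(p)`. -/
def fridmanInv {n : ℕ} (Ω : Set (Fin n → ℂ)) (K : (Fin n → ℂ) → (Fin n → ℂ) → ℂ)
    (p : Fin n → ℂ) : ℝ :=
  sInf { c : ℝ | ∃ r : ℝ, 0 < r ∧ c = 1 / r ∧ ∃ f : (Fin n → ℂ) → (Fin n → ℂ),
    DifferentiableOn ℂ f (euclUnitBall n) ∧ Set.InjOn f (euclUnitBall n) ∧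
    f '' euclUnitBall n ⊆ Ω ∧ bergmanBall Ω K p r ⊆ f '' euclUnitBall n }

/-- Biholomorphic equivalence of domains in `ℂⁿ` (an injective holomorphic map of `ℂⁿ`
restricted to a domain is automatically a biholomorphism onto its image). -/
def Biholomorphic {n : ℕ} (U V : Set (Fin n → ℂ)) : Prop :=
  ∃ f : (Fin n → ℂ) → (Fin n → ℂ),
    DifferentiableOn ℂ f U ∧ Set.InjOn f U ∧ f '' U = V

/-- The Levi form of a real-valued function `ρ` at `p` in direction `ξ`. -/
def leviForm {n : ℕ} (ρ : (Fin n → ℂ) → ℝ) (p ξ : Fin n → ℂ) : ℝ :=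
  (∑ μ, ∑ ν, wderiv μ (fun w => wderivBar ν (fun u => (ρ u : ℂ)) w) p
      * ξ μ * (starRingEnd ℂ) (ξ ν)).re

/-- The complex tangent space of `{ρ = 0}` at `p`. -/
def complexTangent {n : ℕ} (ρ : (Fin n → ℂ) → ℝ) (p : Fin n → ℂ) : Set (Fin n → ℂ) :=
  { ξ | ∑ μ, wderiv μ (fun u => (ρ u : ℂ)) p * ξ μ = 0 }

/-- Strong pseudoconvexity at a boundary point, for defining function `ρ`. -/
def StronglyPseudoconvexAt {n : ℕ} (ρ : (Fin n → ℂ) → ℝ) (p : Fin n → ℂ) : Prop :=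
  ∀ ξ ∈ complexTangent ρ p, ξ ≠ 0 → 0 < leviForm ρ p ξ

/-- `ρ` is a (global) defining function for `D`. -/
def IsDefiningFunction {n : ℕ} (D : Set (Fin n → ℂ)) (ρ : (Fin n → ℂ) → ℝ) : Prop :=
  (∀ z, z ∈ D ↔ ρ z < 0) ∧ ∀ z ∈ frontier D, fderiv ℝ ρ z ≠ 0

/-- Plurisubharmonicity via the sub-mean-value property on complex lines. -/
def PlurisubharmonicOn {n : ℕ} (u : (Fin n → ℂ) → ℝ) (Ω : Set (Fin n → ℂ)) : Prop :=
  UpperSemicontinuousOn u Ω ∧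
  ∀ (a b : Fin n → ℂ) (r : ℝ), 0 < r →
    (∀ w : ℂ, ‖w‖ ≤ r → a + w • b ∈ Ω) →
    u a ≤ (1 / (2 * Real.pi)) *
      ∫ θ in (0:ℝ)..(2 * Real.pi), u (a + ((r : ℂ) * Complex.exp (θ * Complex.I)) • b)

/-- Pseudoconvexity: `-log dist(·, ∂D)` is plurisubharmonic on `D`. -/
def IsPseudoconvex {n : ℕ} (D : Set (Fin n → ℂ)) : Prop :=
  PlurisubharmonicOn (fun z => -Real.log (Metric.infDist z Dᶜ)) D

/-- Order of vanishing at `0` of a vector-valued map on `ℂ` (`⊤` if it vanishes to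
infinite order). -/
def vanishingOrderC {n : ℕ} (f : ℂ → (Fin n → ℂ)) : ℝ≥0∞ :=
  sInf ((fun m : ℕ => (m : ℝ≥0∞)) '' { m : ℕ | iteratedDeriv m f 0 ≠ 0 })

/-- Order of vanishing at `0` of a real-valued function on `ℂ`. -/
def vanishingOrderR (g : ℂ → ℝ) : ℝ≥0∞ :=
  sInf ((fun m : ℕ => (m : ℝ≥0∞)) '' { m : ℕ | iteratedFDeriv ℝ m g 0 ≠ 0 })

/-- The D'Angelo 1-type of `ρ` at `p`. -/
def dAngeloOneType {n : ℕ} (ρ : (Fin n → ℂ) → ℝ) (p : Fin n → ℂ) : ℝ≥0∞ :=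
  ⨆ (φ : ℂ → (Fin n → ℂ)) (_ : AnalyticAt ℂ φ 0) (_ : φ 0 = p)
    (_ : vanishingOrderC (fun w => φ w - p) ≠ ⊤),
    vanishingOrderR (fun w => ρ (φ w)) / vanishingOrderC (fun w => φ w - p)

/-- The Levi form at `p` has at most one degenerate eigenvalue. -/
def LeviCorankOneAt {n : ℕ} (ρ : (Fin n → ℂ) → ℝ) (p : Fin n → ℂ) : Prop :=
  ∃ V : Submodule ℂ (Fin n → ℂ), n - 2 ≤ Module.finrank ℂ V ∧
    (V : Set (Fin n → ℂ)) ⊆ complexTangent ρ p ∧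
    ∀ ξ ∈ V, ξ ≠ 0 → 0 < leviForm ρ p ξ

/-- A bounded smooth pseudoconvex finite-type Levi corank one domain, with defining
function `ρ`. -/
def IsLeviCorankOneDomain {n : ℕ} (D : Set (Fin n → ℂ)) (ρ : (Fin n → ℂ) → ℝ) : Prop :=
  IsOpen D ∧ IsConnected D ∧ Bornology.IsBounded D ∧ IsPseudoconvex D ∧
  ContDiff ℝ (⊤ : ℕ∞) ρ ∧ IsDefiningFunction D ρ ∧
  (∀ p ∈ frontier D, dAngeloOneType ρ p ≠ ⊤) ∧
  ∀ p ∈ frontier D, LeviCorankOneAt ρ p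

/-- The open unit disc in `ℂ`. -/
def openUnitDisc : Set ℂ := Metric.ball 0 1

/-- Tautness of a domain in `ℂⁿ`. -/
def IsTaut {n : ℕ} (D : Set (Fin n → ℂ)) : Prop :=
  ∀ f : ℕ → ℂ → (Fin n → ℂ),
    (∀ k, DifferentiableOn ℂ (f k) openUnitDisc ∧ f k '' openUnitDisc ⊆ D) →
    ∃ φ : ℕ → ℕ, StrictMono φ ∧
      ((∃ g : ℂ → (Fin n → ℂ), DifferentiableOn ℂ g openUnitDisc ∧ g '' openUnitDisc ⊆ D ∧
          TendstoLocallyUniformlyOn (fun k => f (φ k)) g Filter.atTop openUnitDisc) ∨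
        ∀ S : Set ℂ, IsCompact S → S ⊆ openUnitDisc →
          ∀ L : Set (Fin n → ℂ), IsCompact L → L ⊆ D →
            ∀ᶠ k in Filter.atTop, ∀ w ∈ S, f (φ k) w ∉ L)

/-- Convergence of a sequence of domains in the local Hausdorff sense. -/
def LocalHausdorffConv {n : ℕ} (Ω : ℕ → Set (Fin n → ℂ)) (Ωl : Set (Fin n → ℂ)) : Prop :=
  (∀ S : Set (Fin n → ℂ), IsCompact S → S ⊆ Ωl → ∀ᶠ j in Filter.atTop, S ⊆ Ω j) ∧
  ∀ S : Set (Fin n → ℂ), IsCompact S →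
    (∃ j₀ : ℕ, S ⊆ interior (⋂ j, ⋂ (_ : j₀ ≤ j), Ω j)) → S ⊆ Ωl

/-- A real-valued subharmonic polynomial of degree at most `d` in one complex variable,
containing no harmonic terms. -/
def SubharmonicPolyNoHarm (P : ℂ → ℝ) (d : ℕ) : Prop :=
  (∃ c : Fin (d + 1) → Fin (d + 1) → ℂ,
    (∀ j, c j 0 = 0) ∧ (∀ k, c 0 k = 0) ∧
    ∀ w : ℂ, (P w : ℂ) = ∑ j, ∑ k, c j k * w ^ (j : ℕ) * (starRingEnd ℂ) w ^ (k : ℕ)) ∧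
  ∀ w : ℂ, 0 ≤ (wderiv1 (fun u => wderiv1Bar (fun v => (P v : ℂ)) u) w).re

/-- A strictly subharmonic real polynomial of degree `2` in one complex variable. -/
def StrictlySubharmonicPolyDeg2 (Q : ℂ → ℝ) : Prop :=
  (∃ c : Fin 3 → Fin 3 → ℂ, ∀ w : ℂ,
      (Q w : ℂ) = ∑ j, ∑ k, c j k * w ^ (j : ℕ) * (starRingEnd ℂ) w ^ (k : ℕ)) ∧
  ∀ w : ℂ, 0 < (wderiv1 (fun u => wderiv1Bar (fun v => (Q v : ℂ)) u) w).re

/-- A nontangential cone in `D` with vertex `p0 ∈ ∂D`. -/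
def IsNontangentialCone {n : ℕ} (D Γ : Set (Fin n → ℂ)) (p0 : Fin n → ℂ) : Prop :=
  Γ ⊆ D ∧ p0 ∈ closure Γ ∧
  ∃ C : ℝ, 0 < C ∧ ∀ z ∈ Γ, ‖z - p0‖ ≤ C * Metric.infDist z Dᶜ

/-- The Bergman kernel is positive on the diagonal of `Ω`. -/
def DiagPos {n : ℕ} (Ω : Set (Fin n → ℂ)) (K : (Fin n → ℂ) → (Fin n → ℂ) → ℂ) : Prop :=
  ∀ z ∈ Ω, (K z z).im = 0 ∧ 0 < (K z z).re

/-- The Bergman metric of `Ω` is positive definite. -/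
def BergPosDef {n : ℕ} (Ω : Set (Fin n → ℂ)) (K : (Fin n → ℂ) → (Fin n → ℂ) → ℂ) : Prop :=
  ∀ z ∈ Ω, ∀ ξ : Fin n → ℂ, ξ ≠ 0 → 0 < bergmanMetric K z ξ

/-- The real coordinate directions of `ℂⁿ ≃ ℝ^{2n}`. -/
def realDir {n : ℕ} (μ : Fin (2 * n)) : Fin n → ℂ :=
  Pi.single ⟨(μ : ℕ) / 2, by have := μ.isLt; omega⟩
    (if (μ : ℕ) % 2 = 0 then 1 else Complex.I)

/-- The real coefficients `g̃_{μν}` of the Bergman metric, obtained by polarization. -/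
def realTensor {n : ℕ} (K : (Fin n → ℂ) → (Fin n → ℂ) → ℂ) (μ ν : Fin (2 * n))
    (z : Fin n → ℂ) : ℝ :=
  (bergmanQuad K z (realDir μ + realDir ν) - bergmanQuad K z (realDir μ)
    - bergmanQuad K z (realDir ν)) / 2

/-- The Christoffel symbols `Γ^η_{μν}` of the Bergman metric, in real coordinates. -/
def christoffel {n : ℕ} (K : (Fin n → ℂ) → (Fin n → ℂ) → ℂ) (η μ ν : Fin (2 * n))
    (z : Fin n → ℂ) : ℝ :=
  (1 / 2) * ∑ τ : Fin (2 * n),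
    (fderiv ℝ (realTensor K ν τ) z (realDir μ)
      + fderiv ℝ (realTensor K τ μ) z (realDir ν)
      - fderiv ℝ (realTensor K μ ν) z (realDir τ))
    * (Matrix.of fun a b => realTensor K a b z)⁻¹ τ η

/-- `z0 ∈ ∂D` is a local holomorphic peak point of `D`. -/
def IsLocalPeakPoint {n : ℕ} (D : Set (Fin n → ℂ)) (z0 : Fin n → ℂ) : Prop :=
  ∃ U ∈ nhds z0, ∃ g : (Fin n → ℂ) → ℂ,
    DifferentiableOn ℂ g (U ∩ D) ∧ ContinuousOn g (closure (U ∩ D)) ∧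
    g z0 = 1 ∧ ∀ z ∈ closure (U ∩ D), z ≠ z0 → ‖g z‖ < 1

/-- A real polynomial on `ℂⁿ` containing no pluriharmonic terms. -/
def IsPolyNoPluriharm {n : ℕ} (P : (Fin n → ℂ) → ℝ) : Prop :=
  ∃ (d : ℕ) (c : (Fin n → Fin (d + 1)) → (Fin n → Fin (d + 1)) → ℂ),
    (∀ α β, (∀ j, (β j : ℕ) = 0) → c α β = 0) ∧
    (∀ α β, (∀ j, (α j : ℕ) = 0) → c α β = 0) ∧
    ∀ z, (P z : ℂ) = ∑ α, ∑ β, c α β * (∏ j, z j ^ (α j : ℕ)) *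
      ∏ j, (starRingEnd ℂ) (z j) ^ (β j : ℕ)

/-- A probability density on `ℂⁿ` that is smooth, supported in the closed polydisc of radius `r`
and invariant under the diagonal circle action. -/
structure IsCircularMollifier {n : ℕ} (r : ℝ) (χ : (Fin n → ℂ) → ℝ) : Prop where
  contDiff : ContDiff ℝ (⊤ : ℕ∞) χ
  hasCompactSupport : HasCompactSupport χ
  eq_zero : ∀ v, r ≤ ‖v‖ → χ v = 0
  circular : ∀ (c : ℂ) (v : Fin n → ℂ), ‖c‖ = 1 → χ (c • v) = χ v
  nonneg : ∀ v, 0 ≤ χ v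
  integral_eq_one : ∫ v, χ v = 1

theorem exists_isCircularMollifier (n : ℕ) {r : ℝ} (hr : 0 < r) :
    ∃ χ : (Fin n → ℂ) → ℝ, IsCircularMollifier r χ := by
  have hr2 : 0 < r ^ 2 := by positivity
  let η : ContDiffBump (0 : ℝ) := ⟨r ^ 2 / 2, r ^ 2, by positivity, by linarith⟩
  let ψ : (Fin n → ℂ) → ℝ := fun v => η (∑ i, ‖v i‖ ^ 2)
  have hψs : ContDiff ℝ (⊤ : ℕ∞) ψ := by
    refine η.contDiff.comp (ContDiff.sum fun i _ => ?_)
    exact (contDiff_norm_sq ℝ).comp (contDiff_apply ℝ ℂ i)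
  have hψ0 : ∀ v, r ≤ ‖v‖ → ψ v = 0 := by
    intro v hv
    refine η.zero_of_le_dist ?_
    have h1 : r ^ 2 ≤ ∑ i, ‖v i‖ ^ 2 := by
      by_contra! h
      refine absurd hv (not_le.2 ((pi_norm_lt_iff hr).2 fun i => ?_))
      refine lt_of_pow_lt_pow_left₀ 2 hr.le (lt_of_le_of_lt ?_ h)
      exact Finset.single_le_sum (f := fun i => ‖v i‖ ^ 2) (fun j _ => by positivity)
        (Finset.mem_univ i)
    rw [Real.dist_eq, sub_zero]
    exact h1.trans (le_abs_self _)
  have hψc : HasCompactSupport ψ :=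
    HasCompactSupport.of_support_subset_isCompact (isCompact_closedBall 0 r) fun v hv => by
      rw [mem_closedBall_zero_iff]
      by_contra! h
      exact hv (hψ0 v h.le)
  have hpos : 0 < ∫ v, ψ v := by
    refine hψs.continuous.integral_pos_of_hasCompactSupport_nonneg_nonzero hψc
      (fun v => η.nonneg) (x := 0) ?_
    have : ψ 0 = 1 := by
      refine η.one_of_mem_closedBall ?_
      simpa [η] using (by positivity : 0 ≤ r ^ 2 / 2)
    simp [this]
  refine ⟨fun v => (∫ v, ψ v)⁻¹ * ψ v, contDiff_const.mul hψs, hψc.mul_left, fun v hv => ?_,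
    fun c v hc => ?_, fun v => mul_nonneg (inv_nonneg.2 hpos.le) η.nonneg, ?_⟩
  · simp [hψ0 v hv]
  · simp [ψ, hc]
  · rw [integral_const_mul, inv_mul_cancel₀ hpos.ne']

theorem IsCircularMollifier.neg {n : ℕ} {r : ℝ} {χ : (Fin n → ℂ) → ℝ}
    (h : IsCircularMollifier r χ) (v : Fin n → ℂ) : χ (-v) = χ v := by
  simpa using h.circular (-1) v (by simp)

theorem measurePreserving_smul_of_norm_eq_one {n : ℕ} {c : ℂ} (hc : ‖c‖ = 1) :
    MeasurePreserving (fun v : Fin n → ℂ => c • v) := by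
  have h1 : MeasurePreserving (fun z : ℂ => c * z) :=
    (rotation ⟨c, by simpa [Submonoid.unitSphere] using hc⟩).measurePreserving
  exact volume_preserving_pi (fun _ : Fin n => h1)

/-- Mean value property of holomorphic functions on a disc through the centre of a polydisc. -/
theorem circleAverage_slice {n : ℕ} {U : Set (Fin n → ℂ)} {f : (Fin n → ℂ) → ℂ}
    (hf : DifferentiableOn ℂ f U) (hU : IsOpen U) {z v : Fin n → ℂ} {r : ℝ}
    (hz : closedBall z r ⊆ U) (hv : ‖v‖ ≤ r) :
    Real.circleAverage (fun ζ : ℂ => f (z + ζ • v)) 0 1 = f z := by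
  have hd : ∀ ζ ∈ closedBall (0 : ℂ) 1, DifferentiableAt ℂ (fun ζ : ℂ => f (z + ζ • v)) ζ := by
    intro ζ hζ
    have hmem : z + ζ • v ∈ U := hz (by
      rw [mem_closedBall, dist_eq_norm, add_sub_cancel_left, norm_smul]
      have := mem_closedBall_zero_iff.1 hζ
      nlinarith [norm_nonneg v, norm_nonneg ζ])
    exact DifferentiableAt.comp ζ (hf.differentiableAt (hU.mem_nhds hmem)) (by fun_prop)
  have := DiffContOnCl.circleAverage (f := fun ζ : ℂ => f (z + ζ • v)) (c := 0) (R := 1) (by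
    have h2 : DifferentiableOn ℂ (fun ζ : ℂ => f (z + ζ • v)) (closure (ball 0 |1|)) := by
      intro ζ hζ
      exact (hd ζ (by simpa using closure_ball_subset_closedBall hζ)).differentiableWithinAt
    exact h2.diffContOnCl)
  simpa using this

theorem IsCircularMollifier.integral_mul_add {n : ℕ} {r : ℝ} {χ : (Fin n → ℂ) → ℝ}
    (hχ : IsCircularMollifier r χ) {U : Set (Fin n → ℂ)} {f : (Fin n → ℂ) → ℂ}
    (hf : DifferentiableOn ℂ f U) (hU : IsOpen U) {z : Fin n → ℂ} (hz : closedBall z r ⊆ U) :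
    ∫ v, (χ v : ℂ) * f (z + v) = f z := by
  have hrot : ∀ θ : ℝ, ∫ v, (χ v : ℂ) * f (z + circleMap 0 1 θ • v) =
      ∫ v, (χ v : ℂ) * f (z + v) := by
    intro θ
    have hc : ‖circleMap 0 1 θ‖ = 1 := by simp
    rw [← (measurePreserving_smul_of_norm_eq_one (n := n) hc).integral_comp
      (Homeomorph.smulOfNeZero (circleMap 0 1 θ) (by simp)).measurableEmbedding
      (fun v => (χ v : ℂ) * f (z + v))]
    simp_rw [hχ.circular _ _ hc]
  have hset : ∀ g : (Fin n → ℂ) → ℂ,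
      ∫ v, (χ v : ℂ) * g v = ∫ v in closedBall (0 : Fin n → ℂ) r, (χ v : ℂ) * g v := by
    intro g
    refine (setIntegral_eq_integral_of_forall_compl_eq_zero fun v hv => ?_).symm
    rw [mem_closedBall_zero_iff, not_le] at hv
    simp [hχ.eq_zero v hv.le]
  have hint : Integrable (Function.uncurry fun (θ : ℝ) (v : Fin n → ℂ) =>
      (χ v : ℂ) * f (z + circleMap 0 1 θ • v))
      ((volume.restrict (Set.uIoc 0 (2 * Real.pi))).prod
        (volume.restrict (closedBall (0 : Fin n → ℂ) r))) := by
    rw [Measure.prod_restrict]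
    refine IntegrableOn.mono_set (t := Set.uIcc 0 (2 * Real.pi) ×ˢ closedBall 0 r) ?_
      (Set.prod_mono Set.uIoc_subset_uIcc le_rfl)
    refine ContinuousOn.integrableOn_compact (isCompact_uIcc.prod (isCompact_closedBall _ _)) ?_
    refine ContinuousOn.mul ?_ ?_
    · exact (Complex.continuous_ofReal.comp
        (hχ.contDiff.continuous.comp continuous_snd)).continuousOn
    · refine hf.continuousOn.comp (Continuous.continuousOn ?_) ?_
      · exact continuous_const.add
          (((continuous_circleMap 0 1).comp continuous_fst).smul continuous_snd)
      · rintro ⟨θ, v⟩ ⟨-, hv⟩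
        refine hz ?_
        rw [mem_closedBall, dist_eq_norm, add_sub_cancel_left, norm_smul]
        simpa using hv
  have hswap := intervalIntegral_integral_swap (a := 0) (b := 2 * Real.pi) hint
  have hL : ∫ θ in (0 : ℝ)..2 * Real.pi, ∫ v in closedBall (0 : Fin n → ℂ) r,
      (χ v : ℂ) * f (z + circleMap 0 1 θ • v) =
      (2 * Real.pi : ℝ) • ∫ v, (χ v : ℂ) * f (z + v) := by
    simp_rw [← hset (fun v => f (z + circleMap 0 1 _ • v)), hrot]
    simp
  have hR : ∫ v in closedBall (0 : Fin n → ℂ) r, (∫ θ in (0 : ℝ)..2 * Real.pi,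
      (χ v : ℂ) * f (z + circleMap 0 1 θ • v)) = (2 * Real.pi : ℝ) • f z := by
    have : ∀ v ∈ closedBall (0 : Fin n → ℂ) r, (∫ θ in (0 : ℝ)..2 * Real.pi,
        (χ v : ℂ) * f (z + circleMap 0 1 θ • v)) = (χ v : ℂ) * ((2 * Real.pi : ℝ) • f z) := by
      intro v hv
      rw [intervalIntegral.integral_const_mul,
        ← circleAverage_slice hf hU hz (mem_closedBall_zero_iff.1 hv), Real.circleAverage_def,
        smul_inv_smul₀ (by positivity)]
    rw [setIntegral_congr_fun measurableSet_closedBall this,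
      ← hset (fun _ => (2 * Real.pi : ℝ) • f z), integral_mul_const, integral_complex_ofReal,
      hχ.integral_eq_one]
    simp
  rw [hL, hR] at hswap
  exact smul_right_injective ℂ (by positivity : (2 * Real.pi : ℝ) ≠ 0) hswap

/-- A holomorphic function is reproduced by convolution with a circular mollifier. -/
theorem IsCircularMollifier.integral_mul_sub {n : ℕ} {r : ℝ} {χ : (Fin n → ℂ) → ℝ}
    (hχ : IsCircularMollifier r χ) {U : Set (Fin n → ℂ)} {f : (Fin n → ℂ) → ℂ}
    (hf : DifferentiableOn ℂ f U) (hU : IsOpen U) {z : Fin n → ℂ} (hz : closedBall z r ⊆ U) :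
    ∫ a, (χ (z - a) : ℂ) * f a = f z := by
  rw [← hχ.integral_mul_add hf hU hz,
    ← integral_sub_right_eq_self (fun v => (χ v : ℂ) * f (z + v)) z]
  refine integral_congr_ae (Eventually.of_forall fun a => ?_)
  simp [← hχ.neg (z - a)]

namespace IsBergmanKernel

variable {n : ℕ} {Ω : Set (Fin n → ℂ)} {K : (Fin n → ℂ) → (Fin n → ℂ) → ℂ}

theorem conj_symm (hK : IsBergmanKernel Ω K) {z w : Fin n → ℂ} (hz : z ∈ Ω) (hw : w ∈ Ω) :
    K z w = (starRingEnd ℂ) (K w z) := by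
  rw [hK.2 _ (hK.1 w hw) z hz, hK.2 _ (hK.1 z hz) w hw, ← integral_conj]
  refine integral_congr_ae (Eventually.of_forall fun x => ?_)
  simp [mul_comm]

theorem integrable_norm_sq (hK : IsBergmanKernel Ω K) {w : Fin n → ℂ} (hw : w ∈ Ω) :
    Integrable (fun x => ‖K x w‖ ^ 2) (volume.restrict Ω) :=
  (memLp_two_iff_integrable_sq_norm (hK.1 w hw).2.1).1 (hK.1 w hw).2

theorem apply_self (hK : IsBergmanKernel Ω K) {w : Fin n → ℂ} (hw : w ∈ Ω) :
    K w w = ((∫ x in Ω, ‖K x w‖ ^ 2 : ℝ) : ℂ) := by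
  rw [hK.2 _ (hK.1 w hw) w hw, ← integral_complex_ofReal]
  refine integral_congr_ae (Eventually.of_forall fun x => ?_)
  simp [Complex.mul_conj']

theorem norm_apply_le (hK : IsBergmanKernel Ω K) {z w : Fin n → ℂ} (hz : z ∈ Ω) (hw : w ∈ Ω) :
    ‖K z w‖ ≤ ((K z z).re + (K w w).re) / 2 := by
  have h1 := (hK.integrable_norm_sq hz).add (hK.integrable_norm_sq hw)
  rw [hK.apply_self hz, hK.apply_self hw, Complex.ofReal_re, Complex.ofReal_re,
    ← integral_add (hK.integrable_norm_sq hz) (hK.integrable_norm_sq hw), ← integral_div,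
    hK.2 _ (hK.1 w hw) z hz]
  refine norm_integral_le_of_norm_le (h1.div_const 2) (Eventually.of_forall fun x => ?_)
  rw [norm_mul, RCLike.norm_conj]
  nlinarith [sq_nonneg (‖K x w‖ - ‖K x z‖)]

theorem re_apply_self_le (hK : IsBergmanKernel Ω K) (hΩ : IsOpen Ω) {r : ℝ}
    {χ : (Fin n → ℂ) → ℝ} (hχ : IsCircularMollifier r χ) {w : Fin n → ℂ} (hw : w ∈ Ω)
    (hwr : closedBall w r ⊆ Ω) : (K w w).re ≤ ∫ v, χ v ^ 2 := by
  have hsq : Integrable (fun v => χ v ^ 2) :=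
    (hχ.contDiff.continuous.pow 2).integrable_of_hasCompactSupport
      (by simpa [pow_two] using hχ.hasCompactSupport.mul_left (f := χ))
  have hsq' : Integrable (fun a => χ (w - a) ^ 2) := hsq.comp_sub_left w
  have hset : ∫ a in Ω, (χ (w - a) : ℂ) * K a w = K w w := by
    rw [← hχ.integral_mul_sub (hK.1 w hw).1 hΩ hwr]
    refine setIntegral_eq_integral_of_forall_compl_eq_zero fun a ha => ?_
    have : r ≤ ‖w - a‖ := by
      by_contra! h
      exact ha (hwr (by rw [mem_closedBall, dist_comm, dist_eq_norm]; exact h.le))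
    simp [hχ.eq_zero _ this]
  have h1 : ‖K w w‖ ≤ ∫ a in Ω, (χ (w - a) ^ 2 + ‖K a w‖ ^ 2) / 2 := by
    conv_lhs => rw [← hset]
    refine norm_integral_le_of_norm_le
      ((hsq'.restrict.add (hK.integrable_norm_sq hw)).div_const 2)
      (Eventually.of_forall fun x => ?_)
    rw [norm_mul, Complex.norm_real, Real.norm_eq_abs, abs_of_nonneg (hχ.nonneg _)]
    nlinarith [sq_nonneg (χ (w - x) - ‖K x w‖)]
  rw [integral_div, integral_add hsq'.restrict (hK.integrable_norm_sq hw)] at h1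
  have h2 : (K w w).re = ∫ a in Ω, ‖K a w‖ ^ 2 := by rw [hK.apply_self hw, Complex.ofReal_re]
  have h3 : ∫ a in Ω, χ (w - a) ^ 2 ≤ ∫ v, χ v ^ 2 := by
    rw [← integral_sub_left_eq_self (fun v => χ v ^ 2) volume w]
    exact setIntegral_le_integral hsq' (Eventually.of_forall fun a => sq_nonneg _)
  have h4 := (Complex.abs_re_le_norm (K w w)).trans h1
  have h5 := (le_abs_self _).trans h4
  linarith

/-- The kernel is Lipschitz in its first variable where it is bounded. -/
theorem dist_left_le (hK : IsBergmanKernel Ω K) {z z' w : Fin n → ℂ} (hw : w ∈ Ω) {r M : ℝ}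
    (hzr : ball z r ⊆ Ω) (hM : ∀ x ∈ ball z r, ‖K x w‖ ≤ M) (hz' : z' ∈ ball z r) :
    dist (K z' w) (K z w) ≤ 2 * M / r * dist z' z := by
  refine Complex.dist_le_div_mul_dist_of_mapsTo_ball (f := fun x => K x w)
    ((hK.1 w hw).1.mono hzr) (fun x hx => ?_) hz'
  have hz : z ∈ ball z r := mem_ball_self (pos_of_mem_ball hz')
  rw [mem_closedBall, dist_eq_norm]
  linarith [norm_sub_le (K x w) (K z w), hM x hx, hM z hz]

theorem dist_right_le (hK : IsBergmanKernel Ω K) {z w w' : Fin n → ℂ} (hz : z ∈ Ω) {r M : ℝ}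
    (hwr : ball w r ⊆ Ω) (hM : ∀ x ∈ ball w r, ‖K z x‖ ≤ M) (hw' : w' ∈ ball w r) :
    dist (K z w') (K z w) ≤ 2 * M / r * dist w' w := by
  have hw : w ∈ ball w r := mem_ball_self (pos_of_mem_ball hw')
  have h := hK.dist_left_le hz hwr (M := M) (fun x hx => by
    rw [hK.conj_symm (hwr hx) hz, RCLike.norm_conj]; exact hM x hx) hw'
  rwa [hK.conj_symm hz (hwr hw'), hK.conj_symm hz (hwr hw), dist_eq_norm, ← map_sub,
    RCLike.norm_conj, ← dist_eq_norm]

end IsBergmanKernel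

open scoped Convolution BoundedContinuousFunction in
/-- Bergman kernels of domains containing a common ball have, on a smaller ball, diagonals which
are the coordinates of one smooth map with values in the space of bounded sequences. -/
theorem exists_contDiff_diagonal {n : ℕ} {z₀ : Fin n → ℂ} {r : ℝ} (hr : 0 < r)
    {U : ℕ → Set (Fin n → ℂ)} (hU : ∀ i, IsOpen (U i))
    {k : ℕ → (Fin n → ℂ) → (Fin n → ℂ) → ℂ} (hk : ∀ i, IsBergmanKernel (U i) (k i))
    (hball : ∀ i, closedBall z₀ (4 * r) ⊆ U i) :
    ∃ Φ : (Fin n → ℂ) → (ℕ →ᵇ ℂ), ContDiff ℝ (⊤ : ℕ∞) Φ ∧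
      ∀ u ∈ ball z₀ r, ∀ i, Φ u i = k i u u := by
  obtain ⟨χ, hχ⟩ := exists_isCircularMollifier n hr
  set M : ℝ := ∫ v, χ v ^ 2
  set S : Set (Fin n → ℂ) := closedBall z₀ (2 * r) with hS
  have hM : 0 ≤ M := integral_nonneg fun v => sq_nonneg _
  have hsub : ∀ {z}, z ∈ closedBall z₀ (3 * r) → ∀ i, closedBall z r ⊆ U i := fun hz i =>
    (closedBall_subset_closedBall' (by linarith [mem_closedBall.1 hz])).trans (hball i)
  have hmem : ∀ {z}, z ∈ closedBall z₀ (3 * r) → ∀ i, z ∈ U i := fun hz i =>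
    hsub hz i (mem_closedBall_self hr.le)
  have hS3 : S ⊆ closedBall z₀ (3 * r) := closedBall_subset_closedBall (by linarith)
  have hSb : ∀ {z}, z ∈ S → ball z r ⊆ closedBall z₀ (3 * r) := fun hz =>
    ball_subset_closedBall.trans
      (closedBall_subset_closedBall' (by linarith [mem_closedBall.1 hz]))
  have hkM : ∀ i, ∀ z ∈ closedBall z₀ (3 * r), ∀ w ∈ closedBall z₀ (3 * r), ‖k i z w‖ ≤ M := by
    intro i z hz w hw
    have h1 := (hk i).norm_apply_le (hmem hz i) (hmem hw i)
    have h2 := (hk i).re_apply_self_le (hU i) hχ (hmem hz i) (hsub hz i)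
    have h3 := (hk i).re_apply_self_le (hU i) hχ (hmem hw i) (hsub hw i)
    linarith
  classical
  let G : (Fin n → ℂ) × (Fin n → ℂ) → (ℕ →ᵇ ℂ) := fun p =>
    BoundedContinuousFunction.ofNormedAddCommGroupDiscrete
      (fun i => if p ∈ S ×ˢ S then k i p.1 p.2 else 0) M (fun i => by
        split_ifs with h
        · exact hkM i _ (hS3 h.1) _ (hS3 h.2)
        · simpa using hM)
  have hG : ∀ p i, G p i = if p ∈ S ×ˢ S then k i p.1 p.2 else 0 := fun p i => rfl
  have hGcont : ContinuousOn G (S ×ˢ S) := by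
    intro q hq
    have key : ∀ᶠ p in 𝓝[S ×ˢ S] q, dist (G p) (G q) ≤ 2 * (2 * M / r) * dist p q := by
      filter_upwards [self_mem_nhdsWithin, mem_nhdsWithin_of_mem_nhds (ball_mem_nhds q hr)]
        with p hp hpq
      refine (BoundedContinuousFunction.dist_le (by positivity)).2 fun i => ?_
      rw [hG, hG, if_pos hp, if_pos hq]
      have hp1 : dist p.1 q.1 ≤ dist p q := le_max_left _ _
      have hp2 : dist p.2 q.2 ≤ dist p q := le_max_right _ _
      have h1 := (hk i).dist_left_le (z := q.1) (z' := p.1) (hmem (hS3 hp.2) i)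
        (fun x hx => hmem (hSb hq.1 hx) i)
        (fun x hx => hkM i x (hSb hq.1 hx) _ (hS3 hp.2)) (lt_of_le_of_lt hp1 hpq)
      have h2 := (hk i).dist_right_le (w := q.2) (w' := p.2) (hmem (hS3 hq.1) i)
        (fun x hx => hmem (hSb hq.2 hx) i)
        (fun x hx => hkM i _ (hS3 hq.1) x (hSb hq.2 hx)) (lt_of_le_of_lt hp2 hpq)
      have h3 := dist_triangle (k i p.1 p.2) (k i q.1 p.2) (k i q.1 q.2)
      have h4 : 0 ≤ 2 * M / r := by positivity
      nlinarith
    refine tendsto_iff_dist_tendsto_zero.2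
      (squeeze_zero' (Eventually.of_forall fun _ => dist_nonneg) key ?_)
    have : Tendsto (fun p => 2 * (2 * M / r) * dist p q) (𝓝 q) (𝓝 (2 * (2 * M / r) * dist q q)) :=
      (by fun_prop : Continuous fun p => 2 * (2 * M / r) * dist p q).tendsto q
    simpa using this.mono_left nhdsWithin_le_nhds
  have hGint : Integrable G := by
    have hc : IsCompact (S ×ˢ S) := (isCompact_closedBall _ _).prod (isCompact_closedBall _ _)
    have h1 : (S ×ˢ S).indicator G = G := by
      refine Set.indicator_eq_self.2 fun p hp => ?_
      by_contra h
      refine hp (BoundedContinuousFunction.ext fun i => ?_)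
      rw [hG, if_neg h]
      rfl
    rw [← h1, integrable_indicator_iff hc.measurableSet]
    exact hGcont.integrableOn_compact hc
  let X : (Fin n → ℂ) × (Fin n → ℂ) → ℝ := fun p => χ p.1 * χ p.2
  have hX : ContDiff ℝ (⊤ : ℕ∞) X :=
    (hχ.contDiff.comp contDiff_fst).mul (hχ.contDiff.comp contDiff_snd)
  have hXc : HasCompactSupport X := by
    refine HasCompactSupport.of_support_subset_isCompact
      ((isCompact_closedBall 0 r).prod (isCompact_closedBall 0 r)) fun p hp => ?_
    have hp' : χ p.1 ≠ 0 ∧ χ p.2 ≠ 0 := mul_ne_zero_iff.1 hp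
    constructor <;> rw [mem_closedBall_zero_iff] <;> by_contra! h
    · exact hp'.1 (hχ.eq_zero _ h.le)
    · exact hp'.2 (hχ.eq_zero _ h.le)
  let L : (ℕ →ᵇ ℂ) →L[ℝ] ℝ →L[ℝ] (ℕ →ᵇ ℂ) := (ContinuousLinearMap.lsmul ℝ ℝ).flip
  have hconv : ContDiff ℝ (⊤ : ℕ∞) (G ⋆[L, volume] X) :=
    hXc.contDiff_convolution_right L hGint.locallyIntegrable hX
  refine ⟨fun u => (G ⋆[L, volume] X) (u, u),
    hconv.comp (contDiff_id.prodMk contDiff_id), fun u hu i => ?_⟩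
  have hint : Integrable (fun t => L (G t) (X ((u, u) - t))) :=
    hXc.convolutionExists_right L hGint.locallyIntegrable hX.continuous (u, u)
  have hinti := (BoundedContinuousFunction.evalCLM ℝ i).integrable_comp hint
  have hev := (BoundedContinuousFunction.evalCLM ℝ i).integral_comp_comm hint
  have hχS : ∀ {a}, χ (u - a) ≠ 0 → a ∈ S := by
    intro a ha
    have h1 : ‖u - a‖ < r := by
      by_contra! h
      exact ha (hχ.eq_zero _ h)
    rw [hS, mem_closedBall]
    have := dist_triangle a u z₀
    rw [dist_comm a u, dist_eq_norm u a] at this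
    linarith [mem_ball.1 hu]
  have hpt : ∀ t : (Fin n → ℂ) × (Fin n → ℂ),
      BoundedContinuousFunction.evalCLM ℝ i (L (G t) (X ((u, u) - t))) =
        (χ (u - t.1) : ℂ) * ((χ (u - t.2) : ℂ) * k i t.1 t.2) := by
    intro t
    have : BoundedContinuousFunction.evalCLM ℝ i (L (G t) (X ((u, u) - t))) =
        ((χ (u - t.1) * χ (u - t.2) : ℝ) : ℂ) * G t i := by
      simp [L, X]
    rw [this, hG]
    by_cases h1 : χ (u - t.1) = 0
    · simp [h1]
    by_cases h2 : χ (u - t.2) = 0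
    · simp [h2]
    rw [if_pos ⟨hχS h1, hχS h2⟩]
    push_cast
    ring
  have hu3 : u ∈ closedBall z₀ (3 * r) := by
    rw [mem_closedBall]
    linarith [mem_ball.1 hu]
  simp_rw [hpt] at hev hinti
  have h0 : (G ⋆[L, volume] X) (u, u) i =
      ∫ t : (Fin n → ℂ) × (Fin n → ℂ), (χ (u - t.1) : ℂ) * ((χ (u - t.2) : ℂ) * k i t.1 t.2) :=
    hev.symm
  have hinner : ∀ a, (χ (u - a) : ℂ) * ∫ b, (χ (u - b) : ℂ) * k i a b =
      (χ (u - a) : ℂ) * k i a u := by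
    intro a
    by_cases ha : χ (u - a) = 0
    · simp [ha]
    congr 1
    have haU := hmem (hS3 (hχS ha)) i
    rw [(hk i).conj_symm haU (hmem hu3 i),
      ← hχ.integral_mul_sub ((hk i).1 a haU).1 (hU i) (hsub hu3 i), ← integral_conj]
    refine integral_congr_ae (Eventually.of_forall fun b => ?_)
    by_cases hb : χ (u - b) = 0
    · simp [hb]
    · simp [(hk i).conj_symm haU (hmem (hS3 (hχS hb)) i)]
  rw [h0, Measure.volume_eq_prod, integral_prod _ hinti]
  simp_rw [integral_const_mul, hinner]
  exact hχ.integral_mul_sub ((hk i).1 u (hmem hu3 i)).1 (hU i) (hsub hu3 i)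

section Wirtinger

variable {n : ℕ} {f g : (Fin n → ℂ) → ℂ} {z : Fin n → ℂ}

theorem wderiv_congr_of_eventuallyEq (h : f =ᶠ[𝓝 z] g) (μ : Fin n) :
    wderiv μ f z = wderiv μ g z := by
  simp only [wderiv, h.fderiv_eq]

theorem wderivBar_congr_of_eventuallyEq (h : f =ᶠ[𝓝 z] g) (μ : Fin n) :
    wderivBar μ f z = wderivBar μ g z := by
  simp only [wderivBar, h.fderiv_eq]

theorem wderiv_mul (hf : DifferentiableAt ℝ f z) (hg : DifferentiableAt ℝ g z) (μ : Fin n) :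
    wderiv μ (fun w => f w * g w) z = wderiv μ f z * g z + f z * wderiv μ g z := by
  simp only [wderiv, fderiv_fun_mul hf hg]
  simp
  ring

theorem wderiv_comp {h : ℂ → ℂ} {h' : ℂ} (hh : HasDerivAt h h' (f z))
    (hf : DifferentiableAt ℝ f z) (μ : Fin n) :
    wderiv μ (fun w => h (f w)) z = h' * wderiv μ f z := by
  have := (hh.complexToReal_fderiv.comp z hf.hasFDerivAt).fderiv
  simp only [Function.comp_def] at this
  simp only [wderiv, this]
  simp
  ring

theorem wderivBar_comp {h : ℂ → ℂ} {h' : ℂ} (hh : HasDerivAt h h' (f z))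
    (hf : DifferentiableAt ℝ f z) (μ : Fin n) :
    wderivBar μ (fun w => h (f w)) z = h' * wderivBar μ f z := by
  have := (hh.complexToReal_fderiv.comp z hf.hasFDerivAt).fderiv
  simp only [Function.comp_def] at this
  simp only [wderivBar, this]
  simp
  ring

theorem bergmanTensor_eq {K : (Fin n → ℂ) → (Fin n → ℂ) → ℂ} {μ ν : Fin n}
    (hK : ∀ᶠ u in 𝓝 z, K u u = f u ∧ K u u ∈ Complex.slitPlane)
    (hf : Differentiable ℝ f) (hf' : Differentiable ℝ (wderivBar ν f)) :
    bergmanTensor K μ ν z = wderiv μ (wderivBar ν f) z / f z -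
      wderivBar ν f z * wderiv μ f z / f z ^ 2 := by
  have h1 : (fun w => wderivBar ν (fun u => Complex.log (K u u)) w) =ᶠ[𝓝 z]
      fun w => wderivBar ν f w * (f w)⁻¹ := by
    filter_upwards [hK.eventually_nhds] with w hw
    have hw' := hw.self_of_nhds
    rw [wderivBar_congr_of_eventuallyEq (g := fun u => Complex.log (f u))
      (hw.mono fun u hu => by rw [hu.1]), wderivBar_comp
      (Complex.hasDerivAt_log (hw'.1 ▸ hw'.2)) (hf w), mul_comm]
  have hz := hK.self_of_nhds
  have h0 : f z ≠ 0 := hz.1 ▸ Complex.slitPlane_ne_zero hz.2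
  have hinv : DifferentiableAt ℝ (fun w => (f w)⁻¹) z := (hf z).inv h0
  rw [bergmanTensor, wderiv_congr_of_eventuallyEq h1, wderiv_mul (hf' z) hinv,
    wderiv_comp (hasDerivAt_inv h0) (hf z)]
  field_simp
  ring

end Wirtinger

section BoundedSequences

open scoped BoundedContinuousFunction

/-- The bounded sequences whose tail `j ↦ y (j + 1)` converges to the entry `y 0`. -/
def tendsToHead : Submodule ℂ (ℕ →ᵇ ℂ) where
  carrier := {y | Tendsto (fun j => y (j + 1)) atTop (𝓝 (y 0))}
  add_mem' ha hb := ha.add hb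
  zero_mem' := tendsto_const_nhds
  smul_mem' c _ hy := hy.const_smul c

theorem mem_tendsToHead {y : ℕ →ᵇ ℂ} :
    y ∈ tendsToHead ↔ Tendsto (fun j => y (j + 1)) atTop (𝓝 (y 0)) :=
  Iff.rfl

theorem isClosed_tendsToHead : IsClosed (tendsToHead : Set (ℕ →ᵇ ℂ)) := by
  refine isClosed_of_closure_subset fun y hy => ?_
  refine Metric.tendsto_atTop.2 fun ε hε => ?_
  obtain ⟨y', hy', hd⟩ := Metric.mem_closure_iff.1 hy (ε / 3) (by positivity)
  obtain ⟨N, hN⟩ := Metric.tendsto_atTop.1 hy' (ε / 3) (by positivity)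
  refine ⟨N, fun j hj => ?_⟩
  have h1 := BoundedContinuousFunction.dist_coe_le_dist (f := y) (g := y') (j + 1)
  have h2 := BoundedContinuousFunction.dist_coe_le_dist (f := y) (g := y') 0
  rw [dist_comm (y 0)] at h2
  linarith [hN j hj, dist_triangle4 (y (j + 1)) (y' (j + 1)) (y' 0) (y 0)]

theorem tendsto_eval_of_mem_tendsToHead {α : Type*} [TopologicalSpace α] {g : α → (ℕ →ᵇ ℂ)}
    {a : α} (hg : ContinuousAt g a) (ha : g a ∈ tendsToHead) :
    Tendsto (fun p : ℕ × α => g p.2 (p.1 + 1)) (atTop ×ˢ 𝓝 a) (𝓝 (g a 0)) := by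
  have h1 : Tendsto (fun p : ℕ × α => g a (p.1 + 1)) (atTop ×ˢ 𝓝 a) (𝓝 (g a 0)) :=
    (mem_tendsToHead.1 ha).comp tendsto_fst
  refine tendsto_of_tendsto_of_dist h1 (squeeze_zero (fun _ => dist_nonneg)
    (fun p => BoundedContinuousFunction.dist_coe_le_dist (p.1 + 1)) ?_)
  have h2 : Tendsto (fun x => dist (g a) (g x)) (𝓝 a) (𝓝 (dist (g a) (g a))) :=
    tendsto_const_nhds.dist hg
  rw [dist_self] at h2
  exact h2.comp tendsto_snd

theorem fderiv_mem_tendsToHead {E : Type*} [NormedAddCommGroup E] [NormedSpace ℝ E]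
    {g : E → (ℕ →ᵇ ℂ)} {z : E} (hg : DifferentiableAt ℝ g z)
    (hz : ∀ᶠ u in 𝓝 z, g u ∈ tendsToHead) (v : E) : fderiv ℝ g z v ∈ tendsToHead := by
  have hlim := (hg.hasFDerivAt.hasLineDerivAt v).tendsto_slope_zero
  refine isClosed_tendsToHead.mem_of_tendsto hlim ?_
  have hline : Tendsto (fun t : ℝ => z + t • v) (𝓝[≠] 0) (𝓝 z) := by
    have : Continuous fun t : ℝ => z + t • v := by fun_prop
    simpa using (this.tendsto 0).mono_left nhdsWithin_le_nhds
  filter_upwards [hline.eventually hz] with t ht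
  have h2 := tendsToHead.smul_mem ((t : ℂ)⁻¹) (tendsToHead.sub_mem ht hz.self_of_nhds)
  have h3 : t⁻¹ • (g (z + t • v) - g z) = (t : ℂ)⁻¹ • (g (z + t • v) - g z) := by
    ext i
    simp
  exact h3 ▸ h2

variable {n : ℕ}

/-- `wderiv` for maps into the space of bounded sequences. -/
def wderivSeq (μ : Fin n) (g : (Fin n → ℂ) → (ℕ →ᵇ ℂ)) (z : Fin n → ℂ) : ℕ →ᵇ ℂ :=
  (2 : ℂ)⁻¹ • (fderiv ℝ g z (Pi.single μ 1) - Complex.I • fderiv ℝ g z (Pi.single μ Complex.I))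

/-- `wderivBar` for maps into the space of bounded sequences. -/
def wderivBarSeq (μ : Fin n) (g : (Fin n → ℂ) → (ℕ →ᵇ ℂ)) (z : Fin n → ℂ) : ℕ →ᵇ ℂ :=
  (2 : ℂ)⁻¹ • (fderiv ℝ g z (Pi.single μ 1) + Complex.I • fderiv ℝ g z (Pi.single μ Complex.I))

variable {g : (Fin n → ℂ) → (ℕ →ᵇ ℂ)} {z : Fin n → ℂ}

theorem fderiv_eval (hg : DifferentiableAt ℝ g z) (i : ℕ) (v : Fin n → ℂ) :
    fderiv ℝ (fun u => g u i) z v = fderiv ℝ g z v i := by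
  have := ((BoundedContinuousFunction.evalCLM ℝ i).hasFDerivAt.comp z hg.hasFDerivAt).fderiv
  exact DFunLike.congr_fun this v

theorem wderiv_eval (hg : DifferentiableAt ℝ g z) (μ : Fin n) (i : ℕ) :
    wderiv μ (fun u => g u i) z = wderivSeq μ g z i := by
  simp only [wderiv, fderiv_eval hg, wderivSeq]
  simp
  ring

theorem wderivBar_eval (hg : DifferentiableAt ℝ g z) (μ : Fin n) (i : ℕ) :
    wderivBar μ (fun u => g u i) z = wderivBarSeq μ g z i := by
  simp only [wderivBar, fderiv_eval hg, wderivBarSeq]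
  simp
  ring

theorem ContDiff.wderivSeq (hg : ContDiff ℝ (⊤ : ℕ∞) g) (μ : Fin n) :
    ContDiff ℝ (⊤ : ℕ∞) (wderivSeq μ g) := by
  have h : ∀ v, ContDiff ℝ (⊤ : ℕ∞) fun z => fderiv ℝ g z v := fun v =>
    (hg.fderiv_right (m := (⊤ : ℕ∞)) (by simp)).clm_apply contDiff_const
  exact ((h _).sub ((h _).const_smul Complex.I)).const_smul (2 : ℂ)⁻¹

theorem ContDiff.wderivBarSeq (hg : ContDiff ℝ (⊤ : ℕ∞) g) (μ : Fin n) :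
    ContDiff ℝ (⊤ : ℕ∞) (wderivBarSeq μ g) := by
  have h : ∀ v, ContDiff ℝ (⊤ : ℕ∞) fun z => fderiv ℝ g z v := fun v =>
    (hg.fderiv_right (m := (⊤ : ℕ∞)) (by simp)).clm_apply contDiff_const
  exact ((h _).add ((h _).const_smul Complex.I)).const_smul (2 : ℂ)⁻¹

theorem wderivSeq_mem_tendsToHead (hg : DifferentiableAt ℝ g z)
    (hz : ∀ᶠ u in 𝓝 z, g u ∈ tendsToHead) (μ : Fin n) : wderivSeq μ g z ∈ tendsToHead :=
  tendsToHead.smul_mem _ (tendsToHead.sub_mem (fderiv_mem_tendsToHead hg hz _)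
    (tendsToHead.smul_mem _ (fderiv_mem_tendsToHead hg hz _)))

theorem wderivBarSeq_mem_tendsToHead (hg : DifferentiableAt ℝ g z)
    (hz : ∀ᶠ u in 𝓝 z, g u ∈ tendsToHead) (μ : Fin n) : wderivBarSeq μ g z ∈ tendsToHead :=
  tendsToHead.smul_mem _ (tendsToHead.add_mem (fderiv_mem_tendsToHead hg hz _)
    (tendsToHead.smul_mem _ (fderiv_mem_tendsToHead hg hz _)))

end BoundedSequences

/-- Local convergence of the Bergman metric tensors when all domains contain a common ball; the
entry `0` of the sequences plays the role of the limit. -/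
theorem tendsto_bergmanTensor {n : ℕ} {z₀ : Fin n → ℂ} {r : ℝ} (hr : 0 < r)
    {U : ℕ → Set (Fin n → ℂ)} (hU : ∀ i, IsOpen (U i))
    {k : ℕ → (Fin n → ℂ) → (Fin n → ℂ) → ℂ} (hk : ∀ i, IsBergmanKernel (U i) (k i))
    (hball : ∀ i, closedBall z₀ (4 * r) ⊆ U i) (hpos : ∀ i, DiagPos (U i) (k i))
    (hlim : ∀ u ∈ ball z₀ r, Tendsto (fun j => k (j + 1) u u) atTop (𝓝 (k 0 u u)))
    (μ ν : Fin n) :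
    Tendsto (fun p : ℕ × (Fin n → ℂ) => bergmanTensor (k (p.1 + 1)) μ ν p.2) (atTop ×ˢ 𝓝 z₀)
      (𝓝 (bergmanTensor (k 0) μ ν z₀)) ∧
    ContinuousAt (bergmanTensor (k 0) μ ν) z₀ := by
  obtain ⟨Φ, hΦ, hΦk⟩ := exists_contDiff_diagonal hr hU hk hball
  have hdiff : ∀ {g : (Fin n → ℂ) → (BoundedContinuousFunction ℕ ℂ)},
      ContDiff ℝ (⊤ : ℕ∞) g → Differentiable ℝ g := fun h => h.differentiable (by simp)
  have hA := hΦ.wderivBarSeq ν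
  have hB := hA.wderivSeq μ
  have hC := hΦ.wderivSeq μ
  have hmemΦ : ∀ u ∈ ball z₀ r, Φ u ∈ tendsToHead := fun u hu => by
    simpa only [mem_tendsToHead, hΦk u hu] using hlim u hu
  have hnear : ∀ u ∈ ball z₀ r, ball z₀ r ∈ 𝓝 u := fun u hu => isOpen_ball.mem_nhds hu
  have hmemA : ∀ u ∈ ball z₀ r, wderivBarSeq ν Φ u ∈ tendsToHead := fun u hu =>
    wderivBarSeq_mem_tendsToHead (hdiff hΦ u) (mem_of_superset (hnear u hu) hmemΦ) ν
  have hz₀ : z₀ ∈ ball z₀ r := mem_ball_self hr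
  have hmemC := wderivSeq_mem_tendsToHead (hdiff hΦ z₀) (mem_of_superset (hnear z₀ hz₀) hmemΦ) μ
  have hmemB := wderivSeq_mem_tendsToHead (hdiff hA z₀) (mem_of_superset (hnear z₀ hz₀) hmemA) μ
  have hslit : ∀ u ∈ ball z₀ r, ∀ i, k i u u ∈ Complex.slitPlane := fun u hu i =>
    Or.inl (hpos i u (hball i (ball_subset_closedBall (ball_subset_ball (by linarith) hu)))).2
  have hformula : ∀ u ∈ ball z₀ r, ∀ i, bergmanTensor (k i) μ ν u =
      wderivSeq μ (wderivBarSeq ν Φ) u i / Φ u i -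
        wderivBarSeq ν Φ u i * wderivSeq μ Φ u i / Φ u i ^ 2 := by
    intro u hu i
    have heq : wderivBar ν (fun w => Φ w i) = fun w => wderivBarSeq ν Φ w i :=
      funext fun w => wderivBar_eval (hdiff hΦ w) ν i
    have hev : ∀ {g : (Fin n → ℂ) → (BoundedContinuousFunction ℕ ℂ)}, Differentiable ℝ g →
        Differentiable ℝ fun w => g w i := fun {g} h w =>
      ((BoundedContinuousFunction.evalCLM (β := ℂ) ℝ i).hasFDerivAt.comp w
        (h w).hasFDerivAt).differentiableAt
    rw [bergmanTensor_eq (f := fun w => Φ w i)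
      (mem_of_superset (hnear u hu) fun w hw => ⟨(hΦk w hw i).symm, hslit w hw i⟩)
      (hev (hdiff hΦ)) (heq ▸ hev (hdiff hA)), heq, wderiv_eval (hdiff hA u),
      wderiv_eval (hdiff hΦ u)]
  have h0 : Φ z₀ 0 ≠ 0 := by
    rw [hΦk z₀ hz₀]
    exact Complex.slitPlane_ne_zero (hslit z₀ hz₀ 0)
  constructor
  · have tΦ := tendsto_eval_of_mem_tendsToHead hΦ.continuous.continuousAt (hmemΦ z₀ hz₀)
    have tA := tendsto_eval_of_mem_tendsToHead hA.continuous.continuousAt (hmemA z₀ hz₀)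
    have tB := tendsto_eval_of_mem_tendsToHead hB.continuous.continuousAt hmemB
    have tC := tendsto_eval_of_mem_tendsToHead hC.continuous.continuousAt hmemC
    rw [hformula z₀ hz₀]
    refine ((tB.div tΦ h0).sub ((tA.mul tC).div (tΦ.pow 2) (pow_ne_zero 2 h0))).congr' ?_
    have hmem : ∀ᶠ u in 𝓝 z₀, u ∈ ball z₀ r := ball_mem_nhds z₀ hr
    filter_upwards [hmem.prod_inr atTop] with p hp
    exact (hformula p.2 hp _).symm
  · have hev : ∀ {g : (Fin n → ℂ) → (BoundedContinuousFunction ℕ ℂ)}, ContDiff ℝ (⊤ : ℕ∞) g →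
        ContinuousAt (fun w => g w 0) z₀ := fun h =>
      ((BoundedContinuousFunction.evalCLM (β := ℂ) ℝ 0).continuous.comp h.continuous).continuousAt
    refine (((hev hB).div (hev hΦ) h0).sub
      (((hev hA).mul (hev hC)).div ((hev hΦ).pow 2) (pow_ne_zero 2 h0))).congr ?_
    filter_upwards [ball_mem_nhds z₀ hr] with u hu
    exact (hformula u hu 0).symm

theorem tendsto_bergmanMetric {n : ℕ} {α : Type*} {l : Filter α}
    {K : α → (Fin n → ℂ) → (Fin n → ℂ) → ℂ} {K₀ : (Fin n → ℂ) → (Fin n → ℂ) → ℂ}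
    {z ξ : α → Fin n → ℂ} {z₀ ξ₀ : Fin n → ℂ}
    (hK : ∀ μ ν, Tendsto (fun a => bergmanTensor (K a) μ ν (z a)) l
      (𝓝 (bergmanTensor K₀ μ ν z₀))) (hξ : Tendsto ξ l (𝓝 ξ₀)) :
    Tendsto (fun a => bergmanMetric (K a) (z a) (ξ a)) l (𝓝 (bergmanMetric K₀ z₀ ξ₀)) := by
  have hξ' := tendsto_pi_nhds.1 hξ
  refine (Real.continuous_sqrt.tendsto _).comp ((Complex.continuous_re.tendsto _).comp ?_)
  exact tendsto_finsetSum _ fun μ _ => tendsto_finsetSum _ fun ν _ =>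
    ((hK μ ν).mul (hξ' μ)).mul ((Complex.continuous_conj.tendsto _).comp (hξ' ν))


theorem tendsto_bergmanMetric_of_eventuallyEq {n : ℕ}
    {k Kj : ℕ → (Fin n → ℂ) → (Fin n → ℂ) → ℂ} {Kl : (Fin n → ℂ) → (Fin n → ℂ) → ℂ}
    {z₀ ξ₀ : Fin n → ℂ} (hkev : ∀ᶠ j in atTop, k (j + 1) = Kj j)
    (hlocal : ∀ μ ν,
      Tendsto (fun p : ℕ × (Fin n → ℂ) => bergmanTensor (k (p.1 + 1)) μ ν p.2) (atTop ×ˢ 𝓝 z₀)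
        (𝓝 (bergmanTensor Kl μ ν z₀)) ∧ ContinuousAt (bergmanTensor Kl μ ν) z₀) :
    Tendsto (fun p : ℕ × (Fin n → ℂ) × (Fin n → ℂ) => bergmanMetric (Kj p.1) p.2.1 p.2.2)
      (atTop ×ˢ 𝓝 (z₀, ξ₀)) (𝓝 (bergmanMetric Kl z₀ ξ₀)) ∧
    Tendsto (fun p : ℕ × (Fin n → ℂ) × (Fin n → ℂ) => bergmanMetric Kl p.2.1 p.2.2)
      (atTop ×ˢ 𝓝 (z₀, ξ₀)) (𝓝 (bergmanMetric Kl z₀ ξ₀)) := by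
  have hz : Tendsto (fun p : ℕ × (Fin n → ℂ) × (Fin n → ℂ) => p.2.1)
      (atTop ×ˢ 𝓝 (z₀, ξ₀)) (𝓝 z₀) := (continuous_fst.tendsto (z₀, ξ₀)).comp tendsto_snd
  have hξ : Tendsto (fun p : ℕ × (Fin n → ℂ) × (Fin n → ℂ) => p.2.2)
      (atTop ×ˢ 𝓝 (z₀, ξ₀)) (𝓝 ξ₀) := (continuous_snd.tendsto (z₀, ξ₀)).comp tendsto_snd
  constructor
  · refine tendsto_bergmanMetric (K := fun p : ℕ × (Fin n → ℂ) × (Fin n → ℂ) => Kj p.1)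
      (z := fun p => p.2.1) (fun μ ν => ?_) hξ
    refine ((hlocal μ ν).1.comp (tendsto_fst.prodMk hz)).congr' ?_
    filter_upwards [hkev.prod_inl (𝓝 (z₀, ξ₀))] with p hp
    simp only [Function.comp_apply, hp]
  · exact tendsto_bergmanMetric (K := fun _ : ℕ × (Fin n → ℂ) × (Fin n → ℂ) => Kl)
      (z := fun p => p.2.1) (fun μ ν => (hlocal μ ν).2.tendsto.comp hz) hξ

/-- stability of the infinitesimal Bergman metric for a sequence of domains
converging in the local Hausdorff sense, uniformly on compacts of `Ω_∞ × ℂⁿ`. -/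
theorem bergman_metric_stability {n : ℕ} (Ω : ℕ → Set (Fin n → ℂ)) (Ωl : Set (Fin n → ℂ))
    (hopen : ∀ j, IsOpen (Ω j)) (hopenl : IsOpen Ωl)
    (hconv : LocalHausdorffConv Ω Ωl)
    (Kj : ℕ → (Fin n → ℂ) → (Fin n → ℂ) → ℂ) (hKj : ∀ j, IsBergmanKernel (Ω j) (Kj j))
    (Kl : (Fin n → ℂ) → (Fin n → ℂ) → ℂ) (hKl : IsBergmanKernel Ωl Kl)
    (hKjpos : ∀ j, DiagPos (Ω j) (Kj j)) (hKlpos : DiagPos Ωl Kl)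
    (hdiag : ∀ z ∈ Ωl, Filter.Tendsto (fun j => Kj j z z) Filter.atTop (nhds (Kl z z)))
    (hposdef : BergPosDef Ωl Kl) :
    TendstoLocallyUniformlyOn
      (fun j (zξ : (Fin n → ℂ) × (Fin n → ℂ)) => bergmanMetric (Kj j) zξ.1 zξ.2)
      (fun zξ => bergmanMetric Kl zξ.1 zξ.2) Filter.atTop
      (Ωl ×ˢ (Set.univ : Set (Fin n → ℂ))) := by
  classical
  rw [tendstoLocallyUniformlyOn_iff_forall_tendsto]
  rintro ⟨z₀, ξ₀⟩ ⟨hz₀, -⟩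
  obtain ⟨R, hR, hRball⟩ := Metric.nhds_basis_closedBall.mem_iff.1 (hopenl.mem_nhds hz₀)
  obtain ⟨r, hr, rfl⟩ : ∃ r, 0 < r ∧ 4 * r = R := ⟨R / 4, by positivity, by ring⟩
  have hev := hconv.1 _ (isCompact_closedBall z₀ (4 * r)) hRball
  let P : ℕ → Prop := fun j => closedBall z₀ (4 * r) ⊆ Ω j
  let U : ℕ → Set (Fin n → ℂ) := fun i => i.casesOn Ωl fun j => if P j then Ω j else Ωl
  let k : ℕ → (Fin n → ℂ) → (Fin n → ℂ) → ℂ := fun i =>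
    i.casesOn Kl fun j => if P j then Kj j else Kl
  have hcase : ∀ Q : Set (Fin n → ℂ) → ((Fin n → ℂ) → (Fin n → ℂ) → ℂ) → Prop,
      Q Ωl Kl → (∀ j, P j → Q (Ω j) (Kj j)) → ∀ i, Q (U i) (k i) := by
    intro Q hQ hQj i
    cases i with
    | zero => exact hQ
    | succ j =>
      by_cases h : P j
      · simpa [U, k, h] using hQj j h
      · simpa [U, k, h] using hQ
  have hkev : ∀ᶠ j in atTop, k (j + 1) = Kj j := hev.mono fun j hj => if_pos hj
  have hlocal := tendsto_bergmanTensor hr (U := U) (k := k)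
    (hcase (fun V _ => IsOpen V) hopenl fun j _ => hopen j)
    (hcase IsBergmanKernel hKl fun j _ => hKj j)
    (hcase (fun V _ => closedBall z₀ (4 * r) ⊆ V) hRball fun j hj => hj)
    (hcase DiagPos hKlpos fun j _ => hKjpos j)
    (fun u hu => (hdiag u (hRball (ball_subset_closedBall
      (ball_subset_ball (by linarith) hu)))).congr' (hkev.mono fun j hj => by simp only [hj]))
  have hmain := tendsto_bergmanMetric_of_eventuallyEq (ξ₀ := ξ₀) (Kl := k 0) hkev hlocal
  have hboth := (hmain.2.prodMk_nhds hmain.1).mono_right (nhds_le_uniformity _)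
  exact hboth.mono_left (prod_mono le_rfl nhdsWithin_le_nhds)

end
end

section
/- Let Ω^j be a sequence of domains in ℂⁿ converging to a domain Ω_∞ ⊂ ℂⁿ in the local Hausdorff sense, such that K_{Ω^j}(z,z) > 0 and K_{Ω_∞}(z,z) > 0 along the diagonals, K_{Ω^j}(z,z) → K_{Ω_∞}(z,z) for every z ∈ Ω_∞, and the Bergman metrics on Ω^j and Ω_∞ are positive definite. Then for all μ, ν, η = 1, …, 2n, the Christoffel symbols Γ^{η,Ω^j}_{μν} converge to Γ^{η,Ω_∞}_{μν} as j → ∞, uniformly on compact subsets of Ω_∞. -/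
open MeasureTheory Metric Filter Topology Set
open scoped ENNReal

noncomputable section

section HolomorphicFamilies

variable {ι E : Type*} [NormedAddCommGroup E] [NormedSpace ℂ E]

/-- Cauchy's estimate for the Fréchet derivative on a ball. -/
theorem norm_fderiv_le_of_norm_le_on_ball {f : E → ℂ} {x : E} {r C : ℝ} (hr : 0 < r)
    (hd : DifferentiableOn ℂ f (ball x r)) (hC : ∀ z ∈ ball x r, ‖f z‖ ≤ C) :
    ‖fderiv ℂ f x‖ ≤ 2 * C / r := by
  refine Complex.norm_fderiv_le_div_of_mapsTo_ball hd (fun z hz => ?_) hr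
  rw [mem_closedBall, dist_eq_norm]
  linarith [norm_sub_le (f z) (f x), hC z hz, hC x (mem_ball_self hr)]

theorem norm_sub_le_of_norm_le_on_ball {f : E → ℂ} {x z : E} {r C : ℝ}
    (hd : DifferentiableOn ℂ f (ball x r)) (hC : ∀ z ∈ ball x r, ‖f z‖ ≤ C)
    (hz : z ∈ ball x r) : ‖f z - f x‖ ≤ 2 * C / r * ‖z - x‖ := by
  have hr : 0 < r := nonempty_ball.1 ⟨z, hz⟩
  rw [← dist_eq_norm, ← dist_eq_norm]
  refine Complex.dist_le_div_mul_dist_of_mapsTo_ball hd (fun y hy => ?_) hz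
  rw [mem_closedBall, dist_eq_norm]
  linarith [norm_sub_le (f y) (f x), hC y hy, hC x (mem_ball_self hr)]

/-- The first-order Taylor remainder of a bounded holomorphic function is quadratic. -/
theorem norm_sub_sub_fderiv_le_of_norm_le_on_ball {f : E → ℂ} {x z : E} {r C : ℝ}
    (hd : DifferentiableOn ℂ f (ball x r)) (hC : ∀ z ∈ ball x r, ‖f z‖ ≤ C)
    (hz : z ∈ ball x r) :
    ‖f z - f x - fderiv ℂ f x (z - x)‖ ≤ 4 * C * (‖z - x‖ / r) ^ 2 := by
  have hr : 0 < r := nonempty_ball.1 ⟨z, hz⟩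
  have hx : DifferentiableAt ℂ f x := hd.differentiableAt (ball_mem_nhds x hr)
  have key := Complex.dist_le_mul_div_pow_of_mapsTo_ball_of_isLittleO (n := 1) (R₂ := 4 * C)
    (f := fun y => f y - fderiv ℂ f x (y - x)) (c := x) (R₁ := r) (z := z) ?_ ?_ ?_ hz
  · simpa [dist_eq_norm, sub_right_comm] using key
  · exact hd.sub ((fderiv ℂ f x).differentiable.comp
      (differentiable_id.sub_const x)).differentiableOn
  · intro y hy
    rw [mem_closedBall, dist_eq_norm]
    have h1 := (fderiv ℂ f x).le_of_opNorm_le (norm_fderiv_le_of_norm_le_on_ball hr hd hC) (y - x)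
    have h2 : ‖y - x‖ ≤ r := by rw [← dist_eq_norm]; exact (mem_ball.1 hy).le
    have hC0 : 0 ≤ C := (norm_nonneg _).trans (hC x (mem_ball_self hr))
    have h3 : 2 * C / r * ‖y - x‖ ≤ 2 * C := by
      calc 2 * C / r * ‖y - x‖ ≤ 2 * C / r * r := by gcongr
        _ = 2 * C := by field_simp
    have h4 := norm_sub_le (f y - f x) (fderiv ℂ f x (y - x))
    have h5 := norm_sub_le (f y) (f x)
    have h6 := hC y hy
    have h7 := hC x (mem_ball_self hr)
    simp only [sub_self, map_zero, sub_zero]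
    rw [sub_right_comm]
    linarith
  · have := hx.hasFDerivAt.isLittleO
    simp only [sub_self, map_zero, sub_zero, pow_one]
    refine (this.norm_right).congr_left fun y => ?_
    ring

theorem hasFDerivAt_of_norm_sub_sub_le_sq {f : E → ℂ} {x : E} {L : E →L[ℂ] ℂ} {C : ℝ}
    (h : ∀ᶠ z in 𝓝 x, ‖f z - f x - L (z - x)‖ ≤ C * ‖z - x‖ ^ 2) : HasFDerivAt f L x := by
  refine HasFDerivAt.of_isLittleO ?_
  have hO : (fun z => f z - f x - L (z - x)) =O[𝓝 x] fun z => ‖z - x‖ ^ 2 :=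
    Asymptotics.IsBigO.of_bound C (by simpa using h)
  refine hO.trans_isLittleO ?_
  have := (Asymptotics.isLittleO_pow_id (n := 2) (𝕜 := ℝ) (by norm_num)).comp_tendsto
    (k := fun z : E => ‖z - x‖) (l' := 𝓝 x) (by
      simpa using (Continuous.tendsto (f := fun z : E => ‖z - x‖) (by fun_prop) x))
  exact Asymptotics.IsLittleO.of_norm_right this

/-- Osgood's lemma: a bounded separately holomorphic function is jointly holomorphic. -/
theorem differentiableAt_of_separately {E' : Type*} [NormedAddCommGroup E'] [NormedSpace ℂ E']
    {F : E × E' → ℂ} {x : E} {y : E'} {r C : ℝ} (hr : 0 < r)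
    (h1 : ∀ w ∈ ball y r, DifferentiableOn ℂ (fun z => F (z, w)) (ball x r))
    (h2 : ∀ z ∈ ball x r, DifferentiableOn ℂ (fun w => F (z, w)) (ball y r))
    (hC : ∀ z ∈ ball x r, ∀ w ∈ ball y r, ‖F (z, w)‖ ≤ C) : DifferentiableAt ℂ F (x, y) := by
  have hx := mem_ball_self (x := x) hr
  have hy := mem_ball_self (x := y) hr
  have hC0 : 0 ≤ C := (norm_nonneg _).trans (hC x hx y hy)
  refine (hasFDerivAt_of_norm_sub_sub_le_sq (C := 12 * C / r ^ 2)
    (L := (fderiv ℂ (fun z => F (z, y)) x).coprod (fderiv ℂ (fun w => F (x, w)) y))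
    ?_).differentiableAt
  filter_upwards [prod_mem_nhds (ball_mem_nhds x hr) (ball_mem_nhds y hr)] with p hp
  obtain ⟨z, w⟩ := p
  obtain ⟨hz, hw⟩ := hp
  simp only at hz hw
  have q1 := norm_sub_sub_fderiv_le_of_norm_le_on_ball (h1 w hw) (fun z hz => hC z hz w hw) hz
  have q3 := norm_sub_sub_fderiv_le_of_norm_le_on_ball (h2 x hx) (fun w hw => hC x hx w hw) hw
  have q2 : ‖fderiv ℂ (fun z => F (z, w)) x - fderiv ℂ (fun z => F (z, y)) x‖
      ≤ 2 * (2 * C / r * ‖w - y‖) / r := by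
    rw [← fderiv_fun_sub ((h1 w hw).differentiableAt (ball_mem_nhds x hr))
      ((h1 y hy).differentiableAt (ball_mem_nhds x hr))]
    exact norm_fderiv_le_of_norm_le_on_ball hr ((h1 w hw).sub (h1 y hy)) fun z hz =>
      norm_sub_le_of_norm_le_on_ball (h2 z hz) (fun w hw => hC z hz w hw) hw
  have q2' := ContinuousLinearMap.le_of_opNorm_le _ q2 (z - x)
  have n1 : ‖z - x‖ ≤ ‖(z, w) - (x, y)‖ := norm_fst_le ((z, w) - (x, y))
  have n2 : ‖w - y‖ ≤ ‖(z, w) - (x, y)‖ := norm_snd_le ((z, w) - (x, y))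
  set N := ‖(z, w) - (x, y)‖
  have hsplit : F (z, w) - F (x, y) - (fderiv ℂ (fun z => F (z, y)) x).coprod
      (fderiv ℂ (fun w => F (x, w)) y) ((z, w) - (x, y)) =
      (F (z, w) - F (x, w) - fderiv ℂ (fun z => F (z, w)) x (z - x)) +
      (fderiv ℂ (fun z => F (z, w)) x - fderiv ℂ (fun z => F (z, y)) x) (z - x) +
      (F (x, w) - F (x, y) - fderiv ℂ (fun w => F (x, w)) y (w - y)) := by
    simp only [Prod.mk_sub_mk, ContinuousLinearMap.coprod_apply, sub_apply]
    ring
  rw [hsplit]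
  calc _ ≤ 4 * C * (‖z - x‖ / r) ^ 2 + 2 * (2 * C / r * ‖w - y‖) / r * ‖z - x‖
        + 4 * C * (‖w - y‖ / r) ^ 2 := norm_add₃_le.trans (by gcongr)
    _ ≤ 4 * C * (N / r) ^ 2 + 2 * (2 * C / r * N) / r * N + 4 * C * (N / r) ^ 2 := by gcongr
    _ = 12 * C / r ^ 2 * N ^ 2 := by field_simp; ring

theorem Filter.Eventually.exists_ball_of_prod_nhds {X : Type*} [PseudoMetricSpace X]
    {l : Filter ι} {x : X} {P : ι → X → Prop} (h : ∀ᶠ p in l ×ˢ 𝓝 x, P p.1 p.2) :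
    ∃ r > 0, ∀ᶠ i in l, ∀ z ∈ ball x r, P i z := by
  obtain ⟨pa, ha, pb, hb, hab⟩ := eventually_prod_iff.1 h
  obtain ⟨r, hr, hrb⟩ := Metric.eventually_nhds_iff_ball.1 hb
  exact ⟨r, hr, ha.mono fun i hi z hz => hab hi (hrb z hz)⟩

theorem eventually_prod_nhds_of_ball {X : Type*} [PseudoMetricSpace X]
    {l : Filter ι} {x : X} {P : ι → X → Prop} {r : ℝ} (hr : 0 < r)
    (h : ∀ᶠ i in l, ∀ z ∈ ball x r, P i z) : ∀ᶠ p in l ×ˢ 𝓝 x, P p.1 p.2 :=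
  (h.prod_mk (ball_mem_nhds x hr)).mono fun p hp => hp.1 p.2 hp.2

/-- A family of functions that, near `x` and eventually along `l`, is holomorphic and bounded by
`C`. -/
def HolBoundedAt (l : Filter ι) (F : ι → E → ℂ) (x : E) : Prop :=
  ∃ C : ℝ, ∀ᶠ p in l ×ˢ 𝓝 x, DifferentiableAt ℂ (F p.1) p.2 ∧ ‖F p.1 p.2‖ ≤ C

theorem HolBoundedAt.exists_ball {l : Filter ι} {F : ι → E → ℂ} {x : E}
    (h : HolBoundedAt l F x) : ∃ C : ℝ, 0 < C ∧ ∃ r > 0, ∀ᶠ i in l,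
      DifferentiableOn ℂ (F i) (ball x r) ∧ ∀ z ∈ ball x r, ‖F i z‖ ≤ C := by
  obtain ⟨C, hC⟩ := h
  obtain ⟨r, hr, H⟩ := Filter.Eventually.exists_ball_of_prod_nhds
    (P := fun i z => DifferentiableAt ℂ (F i) z ∧ ‖F i z‖ ≤ C) hC
  exact ⟨max C 1, by positivity, r, hr, H.mono fun i hi =>
    ⟨fun z hz => (hi z hz).1.differentiableWithinAt,
      fun z hz => (hi z hz).2.trans (le_max_left _ _)⟩⟩

/-- Pointwise convergence of a locally bounded family of holomorphic functions is continuous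
convergence. -/
theorem HolBoundedAt.tendsto_prod {l : Filter ι} {F : ι → E → ℂ} {x : E} {a : ℂ}
    (h : HolBoundedAt l F x) (ha : Tendsto (fun i => F i x) l (𝓝 a)) :
    Tendsto (fun p : ι × E => F p.1 p.2) (l ×ˢ 𝓝 x) (𝓝 a) := by
  obtain ⟨C, hC0, r, hr, H⟩ := h.exists_ball
  have h1 : Tendsto (fun p : ι × E => F p.1 p.2 - F p.1 x) (l ×ˢ 𝓝 x) (𝓝 0) := by
    refine squeeze_zero_norm' (a := fun p => 2 * C / r * ‖p.2 - x‖) ?_ ?_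
    · filter_upwards [H.prod_mk (ball_mem_nhds x hr)] with p hp
      exact norm_sub_le_of_norm_le_on_ball hp.1.1 hp.1.2 hp.2
    · have : Tendsto (fun z : E => 2 * C / r * ‖z - x‖) (𝓝 x) (𝓝 (2 * C / r * ‖x - x‖)) :=
        Continuous.tendsto (by fun_prop) x
      simp only [sub_self, norm_zero, mul_zero] at this
      exact this.comp tendsto_snd
  simpa using h1.add (ha.comp tendsto_fst)

/-- A pointwise limit of a locally bounded family of holomorphic functions is holomorphic. -/
theorem HolBoundedAt.differentiableAt_of_tendsto [FiniteDimensional ℂ E] {l : Filter ι} [l.NeBot]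
    {F : ι → E → ℂ} {f : E → ℂ} {x : E} (h : HolBoundedAt l F x)
    (hf : ∀ᶠ y in 𝓝 x, Tendsto (fun i => F i y) l (𝓝 (f y))) : DifferentiableAt ℂ f x := by
  obtain ⟨C, hC0, r, hr, H⟩ := h.exists_ball
  have hproper : ProperSpace (E →L[ℂ] ℂ) := FiniteDimensional.proper ℂ _
  let U : Ultrafilter ι := Ultrafilter.of l
  have hU : (U : Filter ι) ≤ l := Ultrafilter.of_le l
  have hL : ∀ᶠ i in (U : Filter ι), fderiv ℂ (F i) x ∈ closedBall (0 : E →L[ℂ] ℂ) (2 * C / r) := by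
    filter_upwards [hU H] with i hi
    simpa using norm_fderiv_le_of_norm_le_on_ball hr hi.1 hi.2
  obtain ⟨L, -, hL'⟩ := (isCompact_closedBall (0 : E →L[ℂ] ℂ) (2 * C / r)).ultrafilter_le_nhds
    (U.map fun i => fderiv ℂ (F i) x) (le_principal_iff.2 hL)
  have hL'' : Tendsto (fun i => fderiv ℂ (F i) x) U (𝓝 L) := hL'
  refine (hasFDerivAt_of_norm_sub_sub_le_sq (L := L) (C := 4 * C / r ^ 2) ?_).differentiableAt
  filter_upwards [hf, ball_mem_nhds x hr] with z hz hzr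
  have ht : Tendsto (fun i => ‖F i z - F i x - fderiv ℂ (F i) x (z - x)‖) U
      (𝓝 ‖f z - f x - L (z - x)‖) :=
    (((hz.mono_left hU).sub (hf.self_of_nhds.mono_left hU)).sub
      (((ContinuousLinearMap.apply ℂ ℂ (z - x)).continuous.tendsto L).comp hL'')).norm
  refine le_of_tendsto ht ?_
  filter_upwards [hU H] with i hi
  refine (norm_sub_sub_fderiv_le_of_norm_le_on_ball hi.1 hi.2 hzr).trans (le_of_eq ?_)
  field_simp

/-- Directional derivatives of holomorphic functions of several variables are holomorphic. -/
theorem DifferentiableOn.differentiableOn_fderiv_apply [FiniteDimensional ℂ E] {f : E → ℂ}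
    {U : Set E} (hU : IsOpen U) (hf : DifferentiableOn ℂ f U) (v : E) :
    DifferentiableOn ℂ (fun z => fderiv ℂ f z v) U := by
  intro x hx
  refine DifferentiableAt.differentiableWithinAt ?_
  obtain ⟨C, hC0, r, hr, hrU, hCb⟩ : ∃ C : ℝ, 0 < C ∧ ∃ r > 0, ball x r ⊆ U ∧
      ∀ z ∈ ball x r, ‖f z‖ ≤ C := by
    have hc : ContinuousAt f x := (hf.differentiableAt (hU.mem_nhds hx)).continuousAt
    have h1 : ∀ᶠ z in 𝓝 x, ‖f z‖ < ‖f x‖ + 1 := hc.norm.eventually_lt_const (by simp)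
    obtain ⟨r, hr, h⟩ := Metric.eventually_nhds_iff_ball.1 (h1.and (hU.mem_nhds hx))
    exact ⟨‖f x‖ + 1, by positivity, r, hr, fun z hz => (h z hz).2, fun z hz => (h z hz).1.le⟩
  have hd := hf.mono hrU
  have hsmall : ∀ᶠ t in 𝓝[≠] (0 : ℂ), ‖t • v‖ < r / 4 := by
    have : Tendsto (fun t : ℂ => ‖t • v‖) (𝓝[≠] 0) (𝓝 ‖(0 : ℂ) • v‖) :=
      (Continuous.tendsto (by fun_prop) 0).mono_left nhdsWithin_le_nhds
    exact this.eventually_lt_const (by simpa using hr)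
  have hB : HolBoundedAt (𝓝[≠] (0 : ℂ)) (fun t z => t⁻¹ * (f (z + t • v) - f z)) x := by
    refine ⟨2 * C / (r / 4) * ‖v‖, eventually_prod_nhds_of_ball (r := r / 4)
      (P := fun t z => DifferentiableAt ℂ (fun z => t⁻¹ * (f (z + t • v) - f z)) z ∧
        ‖t⁻¹ * (f (z + t • v) - f z)‖ ≤ 2 * C / (r / 4) * ‖v‖) (by linarith) ?_⟩
    filter_upwards [hsmall, self_mem_nhdsWithin] with t ht ht0 z hz
    rw [mem_ball, dist_eq_norm] at hz
    have hsub : ball z (r / 4) ⊆ ball x r := ball_subset_ball' (by rw [dist_eq_norm]; linarith)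
    have hz1 : z + t • v ∈ ball x r := hsub (by simpa using ht)
    have hz2 : z ∈ ball x r := hsub (mem_ball_self (by linarith))
    refine ⟨?_, ?_⟩
    · have h1 : DifferentiableAt ℂ f (z + t • v) := hd.differentiableAt (isOpen_ball.mem_nhds hz1)
      have h2 : DifferentiableAt ℂ f z := hd.differentiableAt (isOpen_ball.mem_nhds hz2)
      have h3 : DifferentiableAt ℂ (fun z => f (z + t • v)) z :=
        h1.comp z (differentiableAt_id.add_const _)
      exact (h3.sub h2).const_mul _
    · have h1 := norm_sub_le_of_norm_le_on_ball (hd.mono hsub) (fun y hy => hCb y (hsub hy))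
        (z := z + t • v) (by simpa using ht)
      rw [add_sub_cancel_left, norm_smul] at h1
      rw [norm_mul, norm_inv, inv_mul_le_iff₀ (norm_pos_iff.2 ht0)]
      linarith
  refine hB.differentiableAt_of_tendsto ?_
  filter_upwards [hU.mem_nhds hx] with y hy
  have h1 : HasDerivAt (fun t : ℂ => f (y + t • v)) (fderiv ℂ f y v) 0 :=
    ((hf.differentiableAt (hU.mem_nhds hy)).hasFDerivAt.hasLineDerivAt v)
  have := h1.tendsto_slope_zero
  simpa using this

/-- `F i` is, near every point of `W` and eventually along `l`, holomorphic, and converges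
continuously on `W` to the holomorphic function `f`. -/
structure HolConv (l : Filter ι) (F : ι → E → ℂ) (f : E → ℂ) (W : Set E) : Prop where
  differentiableOn : DifferentiableOn ℂ f W
  eventually_differentiableAt : ∀ x ∈ W, ∀ᶠ p in l ×ˢ 𝓝 x, DifferentiableAt ℂ (F p.1) p.2
  tendsto : ∀ x ∈ W, Tendsto (fun p : ι × E => F p.1 p.2) (l ×ˢ 𝓝 x) (𝓝 (f x))

theorem HolConv.holBoundedAt {l : Filter ι} {F : ι → E → ℂ} {f : E → ℂ} {W : Set E}
    (h : HolConv l F f W) {x : E} (hx : x ∈ W) : HolBoundedAt l F x := by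
  refine ⟨‖f x‖ + 1, (h.eventually_differentiableAt x hx).and ?_⟩
  exact ((h.tendsto x hx).norm.eventually_lt_const (by simp : ‖f x‖ < ‖f x‖ + 1)).mono
    fun p hp => hp.le

/-- Weierstrass: directional derivatives converge as well. -/
theorem HolConv.fderiv_apply [FiniteDimensional ℂ E] {l : Filter ι} {F : ι → E → ℂ} {f : E → ℂ}
    {W : Set E} (hW : IsOpen W) (h : HolConv l F f W) (v : E) :
    HolConv l (fun i z => fderiv ℂ (F i) z v) (fun z => fderiv ℂ f z v) W := by
  refine ⟨h.differentiableOn.differentiableOn_fderiv_apply hW v, fun x hx => ?_, fun x hx => ?_⟩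
  · obtain ⟨C, hC0, r, hr, H⟩ := (h.holBoundedAt hx).exists_ball
    refine eventually_prod_nhds_of_ball
      (P := fun i z => DifferentiableAt ℂ (fun z => fderiv ℂ (F i) z v) z) hr ?_
    filter_upwards [H] with i hi z hz
    exact (hi.1.differentiableOn_fderiv_apply isOpen_ball v).differentiableAt
      (isOpen_ball.mem_nhds hz)
  · obtain ⟨C, hC0, r, hr, H⟩ := (h.holBoundedAt hx).exists_ball
    obtain ⟨C', hC0', r', hr', H'⟩ : ∃ C : ℝ, 0 < C ∧ ∃ r > 0,
        DifferentiableOn ℂ f (ball x r) ∧ ∀ z ∈ ball x r, ‖f z‖ ≤ C := by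
      have hc : ContinuousAt f x :=
        (h.differentiableOn.differentiableAt (hW.mem_nhds hx)).continuousAt
      have h1 : ∀ᶠ z in 𝓝 x, ‖f z‖ < ‖f x‖ + 1 := hc.norm.eventually_lt_const (by simp)
      obtain ⟨r, hr, h'⟩ := Metric.eventually_nhds_iff_ball.1 (h1.and (hW.mem_nhds hx))
      exact ⟨‖f x‖ + 1, by positivity, r, hr, h.differentiableOn.mono fun z hz => (h' z hz).2,
        fun z hz => (h' z hz).1.le⟩
    set A : ℝ := 4 * C * (‖v‖ / (r / 2)) ^ 2 + 4 * C' * (‖v‖ / r') ^ 2 with hA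
    rw [Metric.tendsto_nhds]
    intro ε hε
    obtain ⟨t, ht0, htA, htr, htr', htW⟩ : ∃ t : ℝ, 0 < t ∧ t * A < ε / 2 ∧ t * ‖v‖ < r / 2 ∧
        t * ‖v‖ < r' ∧ x + (t : ℂ) • v ∈ W := by
      have e1 : ∀ᶠ t in 𝓝 (0 : ℝ), t * A < ε / 2 :=
        (Continuous.tendsto' (f := fun t : ℝ => t * A) (by fun_prop) _ _ (zero_mul _))
          |>.eventually_lt_const (by linarith)
      have e2 : ∀ᶠ t in 𝓝 (0 : ℝ), t * ‖v‖ < r / 2 :=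
        (Continuous.tendsto' (f := fun t : ℝ => t * ‖v‖) (by fun_prop) _ _ (zero_mul _))
          |>.eventually_lt_const (by linarith)
      have e3 : ∀ᶠ t in 𝓝 (0 : ℝ), t * ‖v‖ < r' :=
        (Continuous.tendsto' (f := fun t : ℝ => t * ‖v‖) (by fun_prop) _ _ (zero_mul _))
          |>.eventually_lt_const hr'
      have e4 : ∀ᶠ t : ℝ in 𝓝 0, x + (t : ℂ) • v ∈ W :=
        (Continuous.tendsto' (f := fun t : ℝ => x + (t : ℂ) • v) (by fun_prop) _ _ (by simp))
          |>.eventually (hW.mem_nhds hx)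
      have e5 : ∀ᶠ t in 𝓝[>] (0 : ℝ), 0 < t := self_mem_nhdsWithin
      exact (e5.and (((e1.and (e2.and (e3.and e4)))).filter_mono nhdsWithin_le_nhds)).exists
    have htn : ‖(t : ℂ) • v‖ = t * ‖v‖ := by
      rw [norm_smul, Complex.norm_real, Real.norm_of_nonneg ht0.le]
    have hshift : Tendsto (fun p : ι × E => (p.1, p.2 + (t : ℂ) • v)) (l ×ˢ 𝓝 x)
        (l ×ˢ 𝓝 (x + (t : ℂ) • v)) := by
      refine tendsto_fst.prodMk ?_
      have hc : Tendsto (fun z : E => z + (t : ℂ) • v) (𝓝 x) (𝓝 (x + (t : ℂ) • v)) :=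
        Continuous.tendsto (by fun_prop) x
      exact hc.comp tendsto_snd
    have hdiff : Tendsto (fun p : ι × E => (F p.1 (p.2 + (t : ℂ) • v) - F p.1 p.2)
        - (f (x + (t : ℂ) • v) - f x)) (l ×ˢ 𝓝 x) (𝓝 0) := by
      simpa using ((((h.tendsto _ htW).comp hshift).sub (h.tendsto x hx)).sub_const
        (f (x + (t : ℂ) • v) - f x))
    have hsm : ∀ᶠ p in l ×ˢ 𝓝 x, ‖(F p.1 (p.2 + (t : ℂ) • v) - F p.1 p.2)
        - (f (x + (t : ℂ) • v) - f x)‖ < t * (ε / 2) := by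
      have := hdiff.norm
      rw [norm_zero] at this
      exact this.eventually_lt_const (by positivity)
    filter_upwards [hsm, H.prod_mk (ball_mem_nhds x (half_pos hr))] with p hp hq
    obtain ⟨i, z⟩ := p
    obtain ⟨hi, hz⟩ := hq
    simp only at hp hi hz ⊢
    have hsub : ball z (r / 2) ⊆ ball x r := ball_subset_ball' (by linarith [mem_ball.1 hz])
    have q1 := norm_sub_sub_fderiv_le_of_norm_le_on_ball (hi.1.mono hsub)
      (fun y hy => hi.2 y (hsub hy)) (z := z + (t : ℂ) • v) (by
        rwa [mem_ball, dist_eq_norm, add_sub_cancel_left, htn])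
    have q2 := norm_sub_sub_fderiv_le_of_norm_le_on_ball H'.1 H'.2
      (z := x + (t : ℂ) • v) (by
        rwa [mem_ball, dist_eq_norm, add_sub_cancel_left, htn])
    rw [add_sub_cancel_left, htn, map_smul] at q1 q2
    set a := F i (z + (t : ℂ) • v) - F i z
    set b := f (x + (t : ℂ) • v) - f x
    have hsum : 4 * C * (t * ‖v‖ / (r / 2)) ^ 2 + 4 * C' * (t * ‖v‖ / r') ^ 2 = t * (t * A) := by
      rw [hA]; ring
    have h1 : t * ‖fderiv ℂ (F i) z v - fderiv ℂ f x v‖ < t * ε := by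
      calc t * ‖fderiv ℂ (F i) z v - fderiv ℂ f x v‖
          = ‖(t : ℂ) • fderiv ℂ (F i) z v - (t : ℂ) • fderiv ℂ f x v‖ := by
            rw [← smul_sub, norm_smul, Complex.norm_real, Real.norm_of_nonneg ht0.le]
        _ = ‖(a - b) - (a - (t : ℂ) • fderiv ℂ (F i) z v)
              + (b - (t : ℂ) • fderiv ℂ f x v)‖ := by congr 1; ring
        _ ≤ ‖a - b‖ + ‖a - (t : ℂ) • fderiv ℂ (F i) z v‖ + ‖b - (t : ℂ) • fderiv ℂ f x v‖ :=
            (norm_add_le _ _).trans (by gcongr; exact norm_sub_le _ _)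
        _ < t * (ε / 2) + t * (ε / 2) := by nlinarith
        _ = t * ε := by ring
    rw [dist_eq_norm]
    exact lt_of_mul_lt_mul_left h1 ht0.le

theorem HolConv.clog {l : Filter ι} {F : ι → E → ℂ} {f : E → ℂ} {W : Set E}
    (h : HolConv l F f W) (hs : ∀ x ∈ W, f x ∈ Complex.slitPlane) :
    HolConv l (fun i z => Complex.log (F i z)) (fun z => Complex.log (f z)) W := by
  refine ⟨h.differentiableOn.clog hs, fun x hx => ?_, fun x hx => (h.tendsto x hx).clog (hs x hx)⟩
  filter_upwards [h.eventually_differentiableAt x hx,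
    (h.tendsto x hx).eventually (Complex.isOpen_slitPlane.mem_nhds (hs x hx))] with p hp hp'
  exact hp.clog hp'

end HolomorphicFamilies

section BergmanSpace

theorem norm_integral_mul_conj_sq_le {α : Type*} [MeasurableSpace α] {μ : Measure α} {f g : α → ℂ}
    (hf : MemLp f 2 μ) (hg : MemLp g 2 μ) :
    ‖∫ x, f x * (starRingEnd ℂ) (g x) ∂μ‖ ^ 2 ≤ (∫ x, ‖f x‖ ^ 2 ∂μ) * ∫ x, ‖g x‖ ^ 2 ∂μ := by
  have hin : ∀ {u v : α → ℂ} (hu : MemLp u 2 μ) (hv : MemLp v 2 μ),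
      inner ℂ (hv.toLp v) (hu.toLp u) = ∫ x, u x * (starRingEnd ℂ) (v x) ∂μ := by
    intro u v hu hv
    rw [MeasureTheory.L2.inner_def]
    refine integral_congr_ae ?_
    filter_upwards [hu.coeFn_toLp, hv.coeFn_toLp] with x h1 h2
    rw [h1, h2, RCLike.inner_apply]
  have hnorm : ∀ {u : α → ℂ} (hu : MemLp u 2 μ), ‖hu.toLp u‖ ^ 2 = ∫ x, ‖u x‖ ^ 2 ∂μ := by
    intro u hu
    have h1 : ((‖hu.toLp u‖ ^ 2 : ℝ) : ℂ) = ((∫ x, ‖u x‖ ^ 2 ∂μ : ℝ) : ℂ) := by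
      have := inner_self_eq_norm_sq_to_K (𝕜 := ℂ) (hu.toLp u)
      rw [hin hu hu] at this
      rw [← integral_complex_ofReal]
      push_cast
      refine this.symm.trans (integral_congr_ae (.of_forall fun x => ?_))
      simp [Complex.mul_conj, Complex.normSq_eq_norm_sq]
    exact_mod_cast h1
  rw [← hin hf hg, ← hnorm hf, ← hnorm hg, ← mul_pow, mul_comm]
  gcongr
  exact norm_inner_le_norm _ _

variable {n : ℕ}

theorem measurePreserving_smul_of_norm_eq_one_s16 {u : ℂ} (hu : ‖u‖ = 1) :
    MeasurePreserving (fun x : Fin n → ℂ => u • x) := by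
  have h1 : MeasurePreserving (fun x : ℂ => u * x) := by
    have h2 := (rotation ⟨u, mem_sphere_zero_iff_norm.2 hu⟩).measurePreserving
    exact h2
  exact volume_preserving_pi fun _ => h1

/-- Mean value property of holomorphic functions of several variables on polydiscs. -/
theorem setIntegral_closedBall_eq_of_differentiableOn {f : (Fin n → ℂ) → ℂ} {U : Set (Fin n → ℂ)}
    {w : Fin n → ℂ} {r : ℝ} (hf : DifferentiableOn ℂ f U) (hwU : closedBall w r ⊆ U) :
    ∫ z in closedBall w r, f z = volume.real (closedBall (0 : Fin n → ℂ) r) * f w := by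
  have htrans : ∫ z in closedBall w r, f z = ∫ x in closedBall 0 r, f (w + x) := by
    have := (measurePreserving_add_left volume w).setIntegral_preimage_emb
      (MeasurableEquiv.addLeft w).measurableEmbedding f (closedBall w r)
    rw [← this]
    congr 2
    ext x
    simp [dist_eq_norm]
  have hcirc : ∀ x ∈ closedBall (0 : Fin n → ℂ) r, ∀ t : ℂ, ‖t‖ ≤ 1 → w + t • x ∈ U := by
    intro x hx t ht
    refine hwU ?_
    simp only [mem_closedBall, dist_self_add_left, norm_smul, dist_zero_right] at hx ⊢
    exact (mul_le_of_le_one_left (norm_nonneg _) ht).trans hx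
  have hmean : ∀ x ∈ closedBall (0 : Fin n → ℂ) r,
      ∫ θ in (0 : ℝ)..2 * Real.pi, f (w + circleMap 0 1 θ • x) = 2 * Real.pi * f w := by
    intro x hx
    have hd : DifferentiableOn ℂ (fun t : ℂ => f (w + t • x)) (closedBall 0 1) := by
      refine hf.comp (Differentiable.differentiableOn (by fun_prop)) fun t ht => ?_
      exact hcirc x hx t (by simpa using ht)
    have h2 : DiffContOnCl ℂ (fun t : ℂ => f (w + t • x)) (ball 0 |1|) := by
      rw [abs_one]
      exact (hd.mono (closure_ball_subset_closedBall)).diffContOnCl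
    have := h2.circleAverage
    rw [Real.circleAverage_def, inv_smul_eq_iff₀ (by positivity)] at this
    simpa using this
  have hrot : ∀ θ : ℝ, ∫ x in closedBall (0 : Fin n → ℂ) r, f (w + circleMap 0 1 θ • x) =
      ∫ x in closedBall (0 : Fin n → ℂ) r, f (w + x) := by
    intro θ
    have hu : ‖circleMap 0 1 θ‖ = 1 := by simp
    have hu0 : circleMap 0 1 θ ≠ 0 := norm_ne_zero_iff.1 (by rw [hu]; exact one_ne_zero)
    have := (measurePreserving_smul_of_norm_eq_one_s16 (n := n) hu).setIntegral_preimage_emb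
      (MeasurableEquiv.smul₀ (circleMap 0 1 θ) hu0).measurableEmbedding
      (fun x => f (w + x)) (closedBall 0 r)
    rw [← this]
    congr 2
    ext x
    simp [norm_smul]
  have hint : Integrable (Function.uncurry fun (θ : ℝ) (x : Fin n → ℂ) =>
      f (w + circleMap 0 1 θ • x))
      ((volume.restrict (Set.uIoc 0 (2 * Real.pi))).prod (volume.restrict (closedBall 0 r))) := by
    rw [Measure.prod_restrict]
    have hc : ContinuousOn (Function.uncurry fun (θ : ℝ) (x : Fin n → ℂ) =>
        f (w + circleMap 0 1 θ • x)) (Set.uIcc 0 (2 * Real.pi) ×ˢ closedBall 0 r) := by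
      refine hf.continuousOn.comp (f := fun p : ℝ × (Fin n → ℂ) => w + circleMap 0 1 p.1 • p.2)
        (Continuous.continuousOn ?_) fun p hp => ?_
      · have := continuous_circleMap 0 1
        fun_prop
      · exact hcirc p.2 hp.2 _ (by simp)
    exact (hc.integrableOn_compact (isCompact_uIcc.prod (isCompact_closedBall _ _))).mono_set
      (Set.prod_mono Set.uIoc_subset_uIcc subset_rfl)
  have hswap := intervalIntegral_integral_swap hint
  simp only [hrot] at hswap
  rw [setIntegral_congr_fun measurableSet_closedBall hmean] at hswap
  rw [htrans]
  have hpi : (2 * Real.pi : ℂ) ≠ 0 := by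
    exact_mod_cast (by positivity : (2 * Real.pi : ℝ) ≠ 0)
  simp only [intervalIntegral.integral_const, sub_zero, setIntegral_const, Complex.real_smul]
    at hswap
  push_cast at hswap
  apply mul_left_cancel₀ hpi
  linear_combination hswap

variable {Ω : Set (Fin n → ℂ)} {K : (Fin n → ℂ) → (Fin n → ℂ) → ℂ}

theorem IsBergmanKernel.conj_symm_s16 (h : IsBergmanKernel Ω K) {z w : Fin n → ℂ} (hz : z ∈ Ω)
    (hw : w ∈ Ω) : (starRingEnd ℂ) (K w z) = K z w := by
  rw [h.2 _ (h.1 w hw) z hz, h.2 _ (h.1 z hz) w hw, ← integral_conj]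
  refine integral_congr_ae (.of_forall fun x => ?_)
  simp [mul_comm]

theorem IsBergmanKernel.apply_self_s16 (h : IsBergmanKernel Ω K) {w : Fin n → ℂ} (hw : w ∈ Ω) :
    K w w = ((∫ z in Ω, ‖K z w‖ ^ 2 : ℝ) : ℂ) := by
  rw [h.2 _ (h.1 w hw) w hw, ← integral_complex_ofReal]
  refine integral_congr_ae (.of_forall fun x => ?_)
  simp [Complex.mul_conj, Complex.normSq_eq_norm_sq]

theorem IsBergmanKernel.apply_self_re (h : IsBergmanKernel Ω K) {w : Fin n → ℂ} (hw : w ∈ Ω) :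
    (K w w).re = ∫ z in Ω, ‖K z w‖ ^ 2 := by
  rw [h.apply_self_s16 hw, Complex.ofReal_re]

theorem IsBergmanKernel.sq_norm_le (h : IsBergmanKernel Ω K) {f : (Fin n → ℂ) → ℂ}
    (hf : MemA2 Ω f) {w : Fin n → ℂ} (hw : w ∈ Ω) :
    ‖f w‖ ^ 2 ≤ (∫ z in Ω, ‖f z‖ ^ 2) * (K w w).re := by
  rw [h.2 f hf w hw, h.apply_self_re hw]
  exact norm_integral_mul_conj_sq_le hf.2 (h.1 w hw).2

theorem IsBergmanKernel.setIntegral_sq_norm_le (h : IsBergmanKernel Ω K) {w : Fin n → ℂ}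
    (hw : w ∈ Ω) {S : Set (Fin n → ℂ)} (hS : S ⊆ Ω) : ∫ z in S, ‖K z w‖ ^ 2 ≤ (K w w).re := by
  rw [h.apply_self_re hw]
  exact setIntegral_mono_set (h.1 w hw).2.norm.integrable_sq
    (.of_forall fun x => by positivity) (LE.le.eventuallyLE hS)

theorem volume_real_closedBall_pos {r : ℝ} (hr : 0 < r) :
    0 < volume.real (closedBall (0 : Fin n → ℂ) r) :=
  ENNReal.toReal_pos (measure_closedBall_pos _ _ hr).ne' measure_closedBall_lt_top.ne

theorem IsBergmanKernel.apply_self_re_le (h : IsBergmanKernel Ω K) {w : Fin n → ℂ} {r : ℝ}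
    (hr : 0 < r) (hw : closedBall w r ⊆ Ω) :
    (K w w).re ≤ 1 / volume.real (closedBall (0 : Fin n → ℂ) r) := by
  have hwΩ : w ∈ Ω := hw (mem_closedBall_self hr.le)
  have hV := volume_real_closedBall_pos (n := n) hr
  set V := volume.real (closedBall (0 : Fin n → ℂ) r) with hVdef
  have hVw : volume.real (closedBall w r) = V := by
    simp only [hVdef, Measure.real, Measure.addHaar_closedBall_center volume w r]
  have hfin : IsFiniteMeasure (volume.restrict (closedBall w r)) :=
    ⟨by simpa using measure_closedBall_lt_top⟩
  have hcs := norm_integral_mul_conj_sq_le (μ := volume.restrict (closedBall w r))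
    (f := fun z => K z w) (g := fun _ => 1)
    ((h.1 w hwΩ).2.mono_measure (Measure.restrict_mono_set _ hw)) (memLp_const _)
  have hone : ∫ z in closedBall w r, ‖(1 : ℂ)‖ ^ 2 = V := by simp [hVw]
  simp only [map_one, mul_one] at hcs
  rw [setIntegral_closedBall_eq_of_differentiableOn (h.1 w hwΩ).1 hw, norm_mul, hone] at hcs
  have hnn : 0 ≤ (K w w).re := by
    rw [h.apply_self_re hwΩ]
    exact integral_nonneg fun x => by positivity
  have hK : ‖K w w‖ = (K w w).re := by
    have h1 := h.apply_self_s16 hwΩ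
    rw [← h.apply_self_re hwΩ] at h1
    conv_lhs => rw [h1]
    rw [Complex.norm_real, Real.norm_of_nonneg hnn]
  rw [hK, Complex.norm_real, Real.norm_of_nonneg hV.le] at hcs
  have hle := hcs.trans (mul_le_mul_of_nonneg_right (h.setIntegral_sq_norm_le hwΩ hw) hV.le)
  rcases hnn.eq_or_lt with h0 | h0
  · rw [← h0]
    positivity
  · rw [le_div_iff₀ hV]
    have hpos : 0 < (K w w).re * V := by positivity
    exact le_of_mul_le_mul_right (by linarith) hpos

theorem IsBergmanKernel.norm_le (h : IsBergmanKernel Ω K) {z w : Fin n → ℂ} {r : ℝ}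
    (hr : 0 < r) (hz : closedBall z r ⊆ Ω) (hw : closedBall w r ⊆ Ω) :
    ‖K z w‖ ≤ 1 / volume.real (closedBall (0 : Fin n → ℂ) r) := by
  have hzΩ : z ∈ Ω := hz (mem_closedBall_self hr.le)
  have hwΩ : w ∈ Ω := hw (mem_closedBall_self hr.le)
  have h1 := h.sq_norm_le (h.1 w hwΩ) hzΩ
  rw [← h.apply_self_re hwΩ] at h1
  have hV := volume_real_closedBall_pos (n := n) hr
  have hnn : 0 ≤ (K z z).re := by
    rw [h.apply_self_re hzΩ]
    exact integral_nonneg fun x => by positivity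
  refine le_of_sq_le_sq ?_ (by positivity)
  calc ‖K z w‖ ^ 2 ≤ (K w w).re * (K z z).re := h1
    _ ≤ (1 / volume.real (closedBall (0 : Fin n → ℂ) r)) *
      (1 / volume.real (closedBall (0 : Fin n → ℂ) r)) := by
        gcongr
        · exact h.apply_self_re_le hr hw
        · exact h.apply_self_re_le hr hz
    _ = _ := by ring

theorem IsBergmanKernel.differentiableAt_conj_right (hΩ : IsOpen Ω) (h : IsBergmanKernel Ω K)
    {z w : Fin n → ℂ} (hz : z ∈ Ω) (hw : star w ∈ Ω) :
    DifferentiableAt ℂ (fun v => K z (star v)) w := by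
  have h1 : DifferentiableAt ℂ (fun x => K x z) (star w) :=
    (h.1 z hz).1.differentiableAt (hΩ.mem_nhds hw)
  have h2 := h1.star_star
  rw [star_star] at h2
  refine h2.congr_of_eventuallyEq ?_
  have hev : ∀ᶠ v in 𝓝 w, star v ∈ Ω :=
    (continuous_star.tendsto w).eventually (hΩ.mem_nhds hw)
  filter_upwards [hev] with v hv
  exact (h.conj_symm_s16 hz hv).symm

/-- The Bergman kernel, conjugated in its second variable, is jointly holomorphic. -/
theorem IsBergmanKernel.differentiableAt_prod (hΩ : IsOpen Ω) (h : IsBergmanKernel Ω K)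
    {p : (Fin n → ℂ) × (Fin n → ℂ)} (hz : p.1 ∈ Ω) (hw : star p.2 ∈ Ω) :
    DifferentiableAt ℂ (fun q : (Fin n → ℂ) × (Fin n → ℂ) => K q.1 (star q.2)) p := by
  obtain ⟨r, hr, hzr⟩ := Metric.isOpen_iff.1 hΩ p.1 hz
  obtain ⟨s, hs, hws⟩ := Metric.isOpen_iff.1 hΩ (star p.2) hw
  set t := min r s / 2 with ht
  have ht0 : 0 < t := by positivity
  have htr : t + t ≤ r := by rw [ht]; linarith [min_le_left r s]
  have hts : t + t ≤ s := by rw [ht]; linarith [min_le_right r s]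
  have hzt : ∀ z ∈ ball p.1 t, closedBall z (t / 2) ⊆ Ω := fun z hz =>
    (closedBall_subset_ball' (by linarith [mem_ball.1 hz])).trans hzr
  have hwt : ∀ w ∈ ball p.2 t, closedBall (star w) (t / 2) ⊆ Ω := fun w hw =>
    (closedBall_subset_ball' (by
      have := mem_ball.1 hw
      rw [dist_star_star]
      linarith)).trans hws
  have hself : ∀ x : Fin n → ℂ, x ∈ closedBall x (t / 2) := fun x =>
    mem_closedBall_self (by linarith)
  refine differentiableAt_of_separately (x := p.1) (y := p.2) ht0 (fun w hw z hz => ?_)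
    (fun z hz w hw => ?_)
    (fun z hz w hw => h.norm_le (half_pos ht0) (hzt z hz) (hwt w hw))
  · exact (((h.1 _ (hwt w hw (hself _))).1.differentiableAt
      (hΩ.mem_nhds (hzt z hz (hself _))))).differentiableWithinAt
  · exact (h.differentiableAt_conj_right hΩ (hzt z hz (hself _))
      (hwt w hw (hself _))).differentiableWithinAt

theorem tendstoLocallyUniformlyOn_of_tendsto_prod {ι X β : Type*} [TopologicalSpace X]
    [UniformSpace β] {F : ι → X → β} {f : X → β} {s : Set X} {l : Filter ι} (hs : IsOpen s)
    (hF : ∀ x ∈ s, Tendsto (fun p : ι × X => F p.1 p.2) (l ×ˢ 𝓝 x) (𝓝 (f x)))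
    (hf : ContinuousOn f s) : TendstoLocallyUniformlyOn F f l s := by
  rw [hs.tendstoLocallyUniformlyOn_iff_forall_tendsto]
  intro x hx
  have h1 : Tendsto (fun p : ι × X => f p.2) (l ×ˢ 𝓝 x) (𝓝 (f x)) :=
    (hf.continuousAt (hs.mem_nhds hx)).tendsto.comp tendsto_snd
  exact (h1.prodMk_nhds (hF x hx)).mono_right (nhds_le_uniformity _)

theorem memLp_two_of_forall_isCompact {f : (Fin n → ℂ) → ℂ} {U : Set (Fin n → ℂ)} {k : ℝ}
    (hU : IsOpen U) (hf : ContinuousOn f U)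
    (h : ∀ S ⊆ U, IsCompact S → ∫ z in S, ‖f z‖ ^ 2 ≤ k) :
    MemLp f 2 (volume.restrict U) ∧ ∫ z in U, ‖f z‖ ^ 2 ≤ k := by
  obtain ⟨F, hFc, hFU, hFun, hFm⟩ := hU.exists_iUnion_isClosed
  let φ : ℕ → Set (Fin n → ℂ) := fun m => F m ∩ closedBall 0 m
  have hφc : ∀ m, IsCompact (φ m) := fun m => (isCompact_closedBall _ _).inter_left (hFc m)
  have hφU : ∀ m, φ m ⊆ U := fun m => inter_subset_left.trans (hFU m)
  have hcover : AECover (volume.restrict U) atTop φ := by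
    refine ⟨?_, fun m => (hφc m).measurableSet⟩
    filter_upwards [ae_restrict_mem hU.measurableSet] with x hx
    rw [← hFun] at hx
    obtain ⟨m, hm⟩ := mem_iUnion.1 hx
    filter_upwards [eventually_ge_atTop m, eventually_ge_atTop ⌈‖x‖⌉₊] with j hj hj'
    exact ⟨hFm hj hm, by simpa using Nat.ceil_le.1 hj'⟩
  have hrestr : ∀ m, (volume.restrict U).restrict (φ m) = volume.restrict (φ m) := fun m =>
    Measure.restrict_restrict_of_subset (hφU m)
  have hle : ∀ m, ∫ z in φ m, ‖f z‖ ^ 2 ∂(volume.restrict U) ≤ k := fun m => by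
    rw [hrestr]
    exact h _ (hφU m) (hφc m)
  have hint : Integrable (fun z => ‖f z‖ ^ 2) (volume.restrict U) := by
    refine hcover.integrable_of_integral_bounded_of_nonneg_ae k (fun m => ?_)
      (.of_forall fun x => by positivity) (.of_forall hle)
    rw [IntegrableOn, hrestr]
    exact ((hf.mono (hφU m)).norm.pow 2).integrableOn_compact (hφc m)
  refine ⟨(memLp_two_iff_integrable_sq_norm
    (hf.aestronglyMeasurable hU.measurableSet)).2 hint, ?_⟩
  exact le_of_tendsto (hcover.integral_tendsto_of_countably_generated hint) (.of_forall hle)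

theorem IsBergmanKernel.eq_of_integral_sq_le (h : IsBergmanKernel Ω K) {f : (Fin n → ℂ) → ℂ}
    (hf : MemA2 Ω f) {w : Fin n → ℂ} (hw : w ∈ Ω) (hfw : f w = K w w)
    (hle : ∫ z in Ω, ‖f z‖ ^ 2 ≤ (K w w).re) {z : Fin n → ℂ} (hz : z ∈ Ω) : f z = K z w := by
  have hK := h.1 w hw
  have hg : MemA2 Ω fun z => f z - K z w := ⟨hf.1.sub hK.1, hf.2.sub hK.2⟩
  have hfK : Integrable (fun z => f z * (starRingEnd ℂ) (K z w)) (volume.restrict Ω) :=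
    hf.2.integrable_mul hK.2.star
  have hexp : ∫ z in Ω, ‖f z - K z w‖ ^ 2 = (∫ z in Ω, ‖f z‖ ^ 2) -
      2 * (∫ z in Ω, f z * (starRingEnd ℂ) (K z w)).re + ∫ z in Ω, ‖K z w‖ ^ 2 := by
    have hre : (∫ z in Ω, f z * (starRingEnd ℂ) (K z w)).re =
        ∫ z in Ω, (f z * (starRingEnd ℂ) (K z w)).re :=
      (Complex.reCLM.integral_comp_comm hfK).symm
    have i1 := hf.2.norm.integrable_sq
    have i2 : Integrable (fun z => 2 * (f z * (starRingEnd ℂ) (K z w)).re)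
      (volume.restrict Ω) := (Complex.reCLM.integrable_comp hfK).const_mul 2
    have i3 := hK.2.norm.integrable_sq
    have i12 : Integrable (fun z => ‖f z‖ ^ 2 - 2 * (f z * (starRingEnd ℂ) (K z w)).re)
      (volume.restrict Ω) := i1.sub i2
    rw [hre, ← integral_const_mul, ← integral_sub i1 i2, ← integral_add i12 i3]
    refine integral_congr_ae (.of_forall fun x => ?_)
    simp only [← Complex.normSq_eq_norm_sq, Complex.normSq_sub]
    ring
  have hzero : ∫ z in Ω, ‖f z - K z w‖ ^ 2 ≤ 0 := by
    rw [hexp, ← h.2 f hf w hw, hfw, ← h.apply_self_re hw]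
    linarith
  have hnn : 0 ≤ (K z z).re := by
    rw [h.apply_self_re hz]
    exact integral_nonneg fun x => by positivity
  have h1 := (h.sq_norm_le hg hz).trans (mul_nonpos_of_nonpos_of_nonneg hzero hnn)
  have h2 : ‖f z - K z w‖ = 0 := by
    have := sq_nonneg ‖f z - K z w‖
    exact pow_eq_zero_iff (two_ne_zero) |>.1 (le_antisymm h1 this)
  exact sub_eq_zero.1 (norm_eq_zero.1 h2)

variable {Ωj : ℕ → Set (Fin n → ℂ)} {Kj : ℕ → (Fin n → ℂ) → (Fin n → ℂ) → ℂ}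

theorem holBoundedAt_bergmanKernel (hopen : ∀ j, IsOpen (Ωj j)) (hopenl : IsOpen Ω)
    (hsub : ∀ S : Set (Fin n → ℂ), IsCompact S → S ⊆ Ω → ∀ᶠ j in atTop, S ⊆ Ωj j)
    (hKj : ∀ j, IsBergmanKernel (Ωj j) (Kj j)) {p : (Fin n → ℂ) × (Fin n → ℂ)}
    (hz : p.1 ∈ Ω) (hw : star p.2 ∈ Ω) :
    HolBoundedAt atTop (fun j (q : (Fin n → ℂ) × (Fin n → ℂ)) => Kj j q.1 (star q.2)) p := by
  obtain ⟨r, hr, hzr⟩ := (nhds_basis_closedBall.mem_iff).1 (hopenl.mem_nhds hz)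
  obtain ⟨s, hs, hws⟩ := (nhds_basis_closedBall.mem_iff).1 (hopenl.mem_nhds hw)
  set t := min r s / 2 with ht
  have ht0 : 0 < t := by positivity
  have htr : t + t ≤ r := by rw [ht]; linarith [min_le_left r s]
  have hts : t + t ≤ s := by rw [ht]; linarith [min_le_right r s]
  refine ⟨1 / volume.real (closedBall (0 : Fin n → ℂ) t), eventually_prod_nhds_of_ball
    (P := fun j q => DifferentiableAt ℂ
      (fun q : (Fin n → ℂ) × (Fin n → ℂ) => Kj j q.1 (star q.2)) q ∧
      ‖Kj j q.1 (star q.2)‖ ≤ _) ht0 ?_⟩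
  filter_upwards [hsub _ (isCompact_closedBall _ _) hzr, hsub _ (isCompact_closedBall _ _) hws]
    with j hj1 hj2 q hq
  have hq1 : dist q.1 p.1 < t := (le_max_left _ _).trans_lt (mem_ball.1 hq)
  have hq2 : dist (star q.2) (star p.2) < t := by
    rw [dist_star_star]
    exact (le_max_right _ _).trans_lt (mem_ball.1 hq)
  have h1 : closedBall q.1 t ⊆ Ωj j := (closedBall_subset_closedBall' (by linarith)).trans hj1
  have h2 : closedBall (star q.2) t ⊆ Ωj j :=
    (closedBall_subset_closedBall' (by linarith)).trans hj2
  exact ⟨(hKj j).differentiableAt_prod (hopen j) (h1 (mem_closedBall_self ht0.le))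
    (h2 (mem_closedBall_self ht0.le)), (hKj j).norm_le ht0 h1 h2⟩

theorem holBoundedAt_bergmanKernel_left (hopen : ∀ j, IsOpen (Ωj j)) (hopenl : IsOpen Ω)
    (hsub : ∀ S : Set (Fin n → ℂ), IsCompact S → S ⊆ Ω → ∀ᶠ j in atTop, S ⊆ Ωj j)
    (hKj : ∀ j, IsBergmanKernel (Ωj j) (Kj j)) {z w : Fin n → ℂ}
    (hz : z ∈ Ω) (hw : w ∈ Ω) : HolBoundedAt atTop (fun j z => Kj j z w) z := by
  obtain ⟨C, hC⟩ := holBoundedAt_bergmanKernel hopen hopenl hsub hKj (p := (z, star w)) hz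
    (by simpa using hw)
  have hslice : Tendsto (fun p : ℕ × (Fin n → ℂ) => (p.1, (p.2, star w))) (atTop ×ˢ 𝓝 z)
      (atTop ×ˢ 𝓝 (z, star w)) := by
    refine tendsto_fst.prodMk ?_
    exact (Continuous.tendsto (f := fun x : Fin n → ℂ => (x, star w)) (by fun_prop) z).comp
      tendsto_snd
  refine ⟨C, (hslice.eventually hC).mono fun p hp => ⟨?_, by simpa using hp.2⟩⟩
  have hpair : DifferentiableAt ℂ (fun x : Fin n → ℂ => (x, star w)) p.2 := by fun_prop
  have := DifferentiableAt.fun_comp' p.2 hp.1 hpair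
  simpa using this

/-- Ramadanov's theorem: the Bergman kernels converge off the diagonal as soon as they converge on
the diagonal and the domains eventually contain every compact subset of the limit domain. -/
theorem tendsto_bergmanKernel (hopen : ∀ j, IsOpen (Ωj j)) (hopenl : IsOpen Ω)
    (hsub : ∀ S : Set (Fin n → ℂ), IsCompact S → S ⊆ Ω → ∀ᶠ j in atTop, S ⊆ Ωj j)
    (hKj : ∀ j, IsBergmanKernel (Ωj j) (Kj j)) (hK : IsBergmanKernel Ω K)
    (hdiag : ∀ z ∈ Ω, Tendsto (fun j => Kj j z z) atTop (𝓝 (K z z))) {z w : Fin n → ℂ}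
    (hz : z ∈ Ω) (hw : w ∈ Ω) : Tendsto (fun j => Kj j z w) atTop (𝓝 (K z w)) := by
  rw [tendsto_iff_ultrafilter]
  intro U hU
  have hB : ∀ x ∈ Ω, HolBoundedAt (U : Filter ℕ) (fun j z => Kj j z w) x := fun x hx => by
    obtain ⟨C, hC⟩ := holBoundedAt_bergmanKernel_left hopen hopenl hsub hKj hx hw
    exact ⟨C, hC.filter_mono (Filter.prod_mono hU le_rfl)⟩
  have hlim : ∀ x : Fin n → ℂ, ∃ a : ℂ, x ∈ Ω → Tendsto (fun j => Kj j x w) U (𝓝 a) := by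
    intro x
    by_cases hx : x ∈ Ω
    · obtain ⟨C, -, r, hr, H⟩ := (hB x hx).exists_ball
      have hL : ∀ᶠ j in (U : Filter ℕ), Kj j x w ∈ closedBall (0 : ℂ) C := by
        filter_upwards [H] with j hj
        simpa using hj.2 x (mem_ball_self hr)
      obtain ⟨a, -, ha⟩ := (isCompact_closedBall (0 : ℂ) C).ultrafilter_le_nhds
        (U.map fun j => Kj j x w) (le_principal_iff.2 hL)
      exact ⟨a, fun _ => ha⟩
    · exact ⟨0, fun h => absurd h hx⟩
  choose f hf using hlim
  have hfd : DifferentiableOn ℂ f Ω := fun x hx =>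
    ((hB x hx).differentiableAt_of_tendsto
      ((hopenl.eventually_mem hx).mono hf)).differentiableWithinAt
  have hunif : ∀ S ⊆ Ω, IsCompact S →
      TendstoUniformlyOn (fun j x => ‖Kj j x w‖ ^ 2) (fun x => ‖f x‖ ^ 2) U S := by
    refine (tendstoLocallyUniformlyOn_iff_forall_isCompact hopenl).1 ?_
    refine tendstoLocallyUniformlyOn_of_tendsto_prod hopenl (fun x hx => ?_)
      (hfd.continuousOn.norm.pow 2)
    exact ((hB x hx).tendsto_prod (hf x hx)).norm.pow 2
  have hkey : ∀ S ⊆ Ω, IsCompact S → ∫ x in S, ‖f x‖ ^ 2 ≤ (K w w).re := by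
    intro S hSΩ hS
    have hfin : volume S ≠ ⊤ := hS.measure_lt_top.ne
    have hre : Tendsto (fun j => (Kj j w w).re) U (𝓝 (K w w).re) :=
      (Complex.continuous_re.tendsto _).comp ((hdiag w hw).mono_left hU)
    have hε : ∀ ε > 0, ∫ x in S, ‖f x‖ ^ 2 ≤ (K w w).re + ε * volume.real S := by
      intro ε hε
      refine ge_of_tendsto (hre.add_const _) ?_
      have hwj : ∀ᶠ j in (U : Filter ℕ), {w} ⊆ Ωj j :=
        hU (hsub {w} isCompact_singleton (by simpa using hw))
      filter_upwards [Metric.tendstoUniformlyOn_iff.1 (hunif S hSΩ hS) ε hε,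
        hU (hsub S hS hSΩ), hwj] with j hj hSj hwj
      rw [singleton_subset_iff] at hwj
      have i1 : IntegrableOn (fun x => ‖f x‖ ^ 2) S :=
        ((hfd.continuousOn.mono hSΩ).norm.pow 2).integrableOn_compact hS
      have i2 : IntegrableOn (fun x => ‖Kj j x w‖ ^ 2) S :=
        ((((hKj j).1 w hwj).1.continuousOn.mono hSj).norm.pow 2).integrableOn_compact hS
      have i3 : IntegrableOn (fun _ : Fin n → ℂ => ε) S := integrableOn_const hfin
      calc ∫ x in S, ‖f x‖ ^ 2 ≤ ∫ x in S, (‖Kj j x w‖ ^ 2 + ε) := by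
            refine setIntegral_mono_on i1 (i2.add i3) hS.measurableSet fun x hx => ?_
            have := hj x hx
            rw [Real.dist_eq] at this
            linarith [le_abs_self (‖f x‖ ^ 2 - ‖Kj j x w‖ ^ 2)]
        _ = (∫ x in S, ‖Kj j x w‖ ^ 2) + ε * volume.real S := by
            rw [integral_add i2 i3, setIntegral_const, smul_eq_mul, mul_comm]
        _ ≤ (Kj j w w).re + ε * volume.real S := by
            gcongr
            exact (hKj j).setIntegral_sq_norm_le hwj hSj
    have hlim : Tendsto (fun ε : ℝ => (K w w).re + ε * volume.real S) (𝓝[>] 0)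
        (𝓝 ((K w w).re + 0 * volume.real S)) :=
      (Continuous.tendsto (by fun_prop) 0).mono_left nhdsWithin_le_nhds
    rw [zero_mul, add_zero] at hlim
    exact ge_of_tendsto hlim (eventually_mem_nhdsWithin.mono hε)
  obtain ⟨hfL, hfle⟩ := memLp_two_of_forall_isCompact hopenl hfd.continuousOn hkey
  have hfw : f w = K w w := tendsto_nhds_unique (hf w hw) ((hdiag w hw).mono_left hU)
  rw [← hK.eq_of_integral_sq_le ⟨hfd, hfL⟩ hw hfw hfle hz]
  exact hf z hz

theorem holConv_bergmanKernel (hopen : ∀ j, IsOpen (Ωj j)) (hopenl : IsOpen Ω)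
    (hsub : ∀ S : Set (Fin n → ℂ), IsCompact S → S ⊆ Ω → ∀ᶠ j in atTop, S ⊆ Ωj j)
    (hKj : ∀ j, IsBergmanKernel (Ωj j) (Kj j)) (hK : IsBergmanKernel Ω K)
    (hdiag : ∀ z ∈ Ω, Tendsto (fun j => Kj j z z) atTop (𝓝 (K z z))) :
    HolConv atTop (fun j (q : (Fin n → ℂ) × (Fin n → ℂ)) => Kj j q.1 (star q.2))
      (fun q => K q.1 (star q.2)) {p | p.1 ∈ Ω ∧ star p.2 ∈ Ω} where
  differentiableOn p hp := (hK.differentiableAt_prod hopenl hp.1 hp.2).differentiableWithinAt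
  eventually_differentiableAt p hp := by
    obtain ⟨C, hC⟩ := holBoundedAt_bergmanKernel hopen hopenl hsub hKj hp.1 hp.2
    exact hC.mono fun q hq => hq.1
  tendsto p hp := (holBoundedAt_bergmanKernel hopen hopenl hsub hKj hp.1 hp.2).tendsto_prod
    (tendsto_bergmanKernel hopen hopenl hsub hKj hK hdiag hp.1 hp.2)

end BergmanSpace

section BergmanTensor

theorem HolConv.const_mul {ι E : Type*} [NormedAddCommGroup E] [NormedSpace ℂ E] {l : Filter ι}
    {F : ι → E → ℂ} {f : E → ℂ} {W : Set E} (h : HolConv l F f W) (c : ℂ) :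
    HolConv l (fun i z => c * F i z) (fun z => c * f z) W where
  differentiableOn := h.differentiableOn.const_mul c
  eventually_differentiableAt x hx :=
    (h.eventually_differentiableAt x hx).mono fun _ hp => hp.const_mul c
  tendsto x hx := (h.tendsto x hx).const_mul c

theorem HolConv.sum {ι E α : Type*} [NormedAddCommGroup E] [NormedSpace ℂ E] {l : Filter ι}
    {F : α → ι → E → ℂ} {f : α → E → ℂ} {W : Set E} {s : Finset α}
    (h : ∀ a ∈ s, HolConv l (F a) (f a) W) :
    HolConv l (fun i z => ∑ a ∈ s, F a i z) (fun z => ∑ a ∈ s, f a z) W where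
  differentiableOn := DifferentiableOn.fun_sum fun a ha => (h a ha).differentiableOn
  eventually_differentiableAt x hx :=
    ((Finset.eventually_all s).2 fun a ha => (h a ha).eventually_differentiableAt x hx).mono
      fun _ hp => DifferentiableAt.fun_sum hp
  tendsto x hx := tendsto_finsetSum s fun a ha => (h a ha).tendsto x hx

theorem HolConv.mono {ι E : Type*} [NormedAddCommGroup E] [NormedSpace ℂ E] {l : Filter ι}
    {F : ι → E → ℂ} {f : E → ℂ} {W W' : Set E} (h : HolConv l F f W) (hW : W' ⊆ W) :
    HolConv l F f W' where
  differentiableOn := h.differentiableOn.mono hW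
  eventually_differentiableAt x hx := h.eventually_differentiableAt x (hW hx)
  tendsto x hx := h.tendsto x (hW hx)

variable {n : ℕ}

theorem hasFDerivAt_comp_star {G : (Fin n → ℂ) × (Fin n → ℂ) → ℂ} {z : Fin n → ℂ}
    (hG : DifferentiableAt ℂ G (z, star z)) :
    HasFDerivAt (𝕜 := ℝ) (fun u => G (u, star u))
      (((fderiv ℂ G (z, star z)).restrictScalars ℝ).comp
      ((ContinuousLinearMap.id ℝ (Fin n → ℂ)).prod
        (starL' ℝ : (Fin n → ℂ) ≃L[ℝ] (Fin n → ℂ)))) z := by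
  have h1 := hG.hasFDerivAt.restrictScalars ℝ
  have h2 : HasFDerivAt (𝕜 := ℝ) (fun u : Fin n → ℂ => (u, star u))
      ((ContinuousLinearMap.id ℝ (Fin n → ℂ)).prod
        (starL' ℝ : (Fin n → ℂ) ≃L[ℝ] (Fin n → ℂ))) z :=
    (hasFDerivAt_id z).prodMk (starL' ℝ : (Fin n → ℂ) ≃L[ℝ] (Fin n → ℂ)).hasFDerivAt
  exact HasFDerivAt.comp z h1 h2

theorem fderiv_comp_star_apply {G : (Fin n → ℂ) × (Fin n → ℂ) → ℂ} {z : Fin n → ℂ}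
    (hG : DifferentiableAt ℂ G (z, star z)) (v : Fin n → ℂ) :
    fderiv ℝ (fun u => G (u, star u)) z v = fderiv ℂ G (z, star z) (v, star v) := by
  rw [(hasFDerivAt_comp_star hG).fderiv]
  rfl

theorem map_single_I (L : (Fin n → ℂ) × (Fin n → ℂ) →L[ℂ] ℂ) (ν : Fin n) :
    L (Pi.single ν Complex.I, star (Pi.single ν Complex.I)) =
      Complex.I * (L (Pi.single ν 1, 0) - L (0, Pi.single ν 1)) := by
  have h : ((Pi.single ν Complex.I, star (Pi.single ν Complex.I)) : (Fin n → ℂ) × (Fin n → ℂ)) =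
      Complex.I • (((Pi.single ν 1, 0) : (Fin n → ℂ) × (Fin n → ℂ)) - (0, Pi.single ν 1)) := by
    ext i
    · by_cases hi : i = ν
      · subst hi; simp
      · simp [hi]
    · by_cases hi : i = ν
      · subst hi; simp
      · simp [hi]
  rw [h, map_smul, map_sub, smul_eq_mul]

theorem map_single_one (L : (Fin n → ℂ) × (Fin n → ℂ) →L[ℂ] ℂ) (ν : Fin n) :
    L (Pi.single ν 1, star (Pi.single ν 1)) =
      L (Pi.single ν 1, 0) + L (0, Pi.single ν 1) := by
  have hs : star (Pi.single ν 1 : Fin n → ℂ) = Pi.single ν 1 := by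
    rw [← Pi.single_star, star_one]
  rw [hs, ← map_add, Prod.mk_add_mk, add_zero, zero_add]

theorem wderiv_comp_star {G : (Fin n → ℂ) × (Fin n → ℂ) → ℂ} {z : Fin n → ℂ}
    (hG : DifferentiableAt ℂ G (z, star z)) (μ : Fin n) :
    wderiv μ (fun u => G (u, star u)) z = fderiv ℂ G (z, star z) (Pi.single μ 1, 0) := by
  rw [wderiv, fderiv_comp_star_apply hG, fderiv_comp_star_apply hG, map_single_I, map_single_one]
  linear_combination (-1 / 2) * (fderiv ℂ G (z, star z) (Pi.single μ 1, 0) -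
    fderiv ℂ G (z, star z) (0, Pi.single μ 1)) * Complex.I_mul_I

theorem wderivBar_comp_star {G : (Fin n → ℂ) × (Fin n → ℂ) → ℂ} {z : Fin n → ℂ}
    (hG : DifferentiableAt ℂ G (z, star z)) (μ : Fin n) :
    wderivBar μ (fun u => G (u, star u)) z = fderiv ℂ G (z, star z) (0, Pi.single μ 1) := by
  rw [wderivBar, fderiv_comp_star_apply hG, fderiv_comp_star_apply hG, map_single_I,
    map_single_one]
  linear_combination (1 / 2) * (fderiv ℂ G (z, star z) (Pi.single μ 1, 0) -
    fderiv ℂ G (z, star z) (0, Pi.single μ 1)) * Complex.I_mul_I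

/-- The logarithm of a kernel as a function of `(z, w̄)`. -/
def logKernel (K : (Fin n → ℂ) → (Fin n → ℂ) → ℂ) (p : (Fin n → ℂ) × (Fin n → ℂ)) : ℂ :=
  Complex.log (K p.1 (star p.2))

/-- The polarization of `bergmanTensor K a b`. -/
def polarTensor (K : (Fin n → ℂ) → (Fin n → ℂ) → ℂ) (a b : Fin n)
    (p : (Fin n → ℂ) × (Fin n → ℂ)) : ℂ :=
  fderiv ℂ (fun q => fderiv ℂ (logKernel K) q (0, Pi.single b 1)) p (Pi.single a 1, 0)

/-- The polarization of the function whose real part is `realTensor K μ ν`. -/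
def polarRealTensor (K : (Fin n → ℂ) → (Fin n → ℂ) → ℂ) (μ ν : Fin (2 * n))
    (p : (Fin n → ℂ) × (Fin n → ℂ)) : ℂ :=
  ∑ a, ∑ b, ((realDir μ a * (starRingEnd ℂ) (realDir ν b)
    + realDir ν a * (starRingEnd ℂ) (realDir μ b)) / 2) * polarTensor K a b p

/-- The set where the polarized logarithm of the kernel is well behaved. -/
def logDomain (Ω : Set (Fin n → ℂ)) (K : (Fin n → ℂ) → (Fin n → ℂ) → ℂ) :
    Set ((Fin n → ℂ) × (Fin n → ℂ)) :=
  {p | p.1 ∈ Ω ∧ star p.2 ∈ Ω} ∩ (fun p => K p.1 (star p.2)) ⁻¹' Complex.slitPlane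

theorem isOpen_conjSquare {Ω : Set (Fin n → ℂ)} (hΩ : IsOpen Ω) :
    IsOpen {p : (Fin n → ℂ) × (Fin n → ℂ) | p.1 ∈ Ω ∧ star p.2 ∈ Ω} :=
  (hΩ.preimage continuous_fst).inter (hΩ.preimage (continuous_star.comp continuous_snd))

variable {Ω : Set (Fin n → ℂ)} {K : (Fin n → ℂ) → (Fin n → ℂ) → ℂ}

theorem IsBergmanKernel.isOpen_logDomain (hΩ : IsOpen Ω) (h : IsBergmanKernel Ω K) :
    IsOpen (logDomain Ω K) := by
  refine ContinuousOn.isOpen_inter_preimage (fun p hp => ?_) (isOpen_conjSquare hΩ)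
    Complex.isOpen_slitPlane
  exact (h.differentiableAt_prod hΩ hp.1 hp.2).continuousAt.continuousWithinAt

theorem DiagPos.mem_logDomain (h : DiagPos Ω K) {z : Fin n → ℂ} (hz : z ∈ Ω) :
    (z, star z) ∈ logDomain Ω K := by
  refine ⟨⟨hz, by simpa using hz⟩, ?_⟩
  simp only [mem_preimage, star_star]
  exact Or.inl (h z hz).2

theorem IsBergmanKernel.differentiableOn_logKernel (hΩ : IsOpen Ω) (h : IsBergmanKernel Ω K) :
    DifferentiableOn ℂ (logKernel K) (logDomain Ω K) := fun _ hp =>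
  ((h.differentiableAt_prod hΩ hp.1.1 hp.1.2).clog hp.2).differentiableWithinAt

theorem IsBergmanKernel.bergmanTensor_eq (hΩ : IsOpen Ω) (h : IsBergmanKernel Ω K)
    (hpos : DiagPos Ω K) (a b : Fin n) {z : Fin n → ℂ} (hz : z ∈ Ω) :
    bergmanTensor K a b z = polarTensor K a b (z, star z) := by
  have hW := h.isOpen_logDomain hΩ
  have hL := h.differentiableOn_logKernel hΩ
  have hev : (fun w => wderivBar b (fun u => Complex.log (K u u)) w) =ᶠ[𝓝 z]
      fun w => (fun q => fderiv ℂ (logKernel K) q (0, Pi.single b 1)) (w, star w) := by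
    filter_upwards [hΩ.mem_nhds hz] with w hw
    have := wderivBar_comp_star (hL.differentiableAt (hW.mem_nhds (hpos.mem_logDomain hw))) b
    simpa [logKernel] using this
  rw [bergmanTensor, wderiv, hev.fderiv_eq, polarTensor, ← wderiv_comp_star, wderiv]
  exact (hL.differentiableOn_fderiv_apply hW _).differentiableAt
    (hW.mem_nhds (hpos.mem_logDomain hz))

/-- The real bilinear form obtained from the hermitian form of the Bergman metric. -/
def bergmanBilin (K : (Fin n → ℂ) → (Fin n → ℂ) → ℂ) (z : Fin n → ℂ) :
    (Fin n → ℂ) →ₗ[ℝ] (Fin n → ℂ) →ₗ[ℝ] ℝ :=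
  LinearMap.mk₂ ℝ
    (fun ξ ζ => (∑ a, ∑ b, bergmanTensor K a b z * ξ a * (starRingEnd ℂ) (ζ b)).re)
    (fun ξ ξ' ζ => by
      rw [← Complex.add_re, ← Finset.sum_add_distrib]
      simp only [← Finset.sum_add_distrib, Pi.add_apply, mul_add, add_mul])
    (fun c ξ ζ => by
      rw [smul_eq_mul, ← Complex.re_ofReal_mul]
      simp only [Finset.mul_sum, Pi.smul_apply, Complex.real_smul]
      congr 1
      exact Finset.sum_congr rfl fun a _ => Finset.sum_congr rfl fun b _ => by ring)
    (fun ξ ζ ζ' => by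
      rw [← Complex.add_re, ← Finset.sum_add_distrib]
      simp only [← Finset.sum_add_distrib, Pi.add_apply, mul_add, map_add])
    (fun c ξ ζ => by
      rw [smul_eq_mul, ← Complex.re_ofReal_mul]
      simp only [Finset.mul_sum, Pi.smul_apply, Complex.real_smul, map_mul, Complex.conj_ofReal]
      congr 1
      exact Finset.sum_congr rfl fun a _ => Finset.sum_congr rfl fun b _ => by ring)

theorem bergmanQuad_eq_bilin (z ξ : Fin n → ℂ) : bergmanQuad K z ξ = bergmanBilin K z ξ ξ :=
  rfl

theorem realTensor_eq_bilin (μ ν : Fin (2 * n)) (z : Fin n → ℂ) :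
    realTensor K μ ν z = (bergmanBilin K z (realDir μ) (realDir ν)
      + bergmanBilin K z (realDir ν) (realDir μ)) / 2 := by
  rw [realTensor, bergmanQuad_eq_bilin, bergmanQuad_eq_bilin, bergmanQuad_eq_bilin]
  simp only [map_add, LinearMap.add_apply]
  ring

theorem IsBergmanKernel.realTensor_eq (hΩ : IsOpen Ω) (h : IsBergmanKernel Ω K)
    (hpos : DiagPos Ω K) (μ ν : Fin (2 * n)) {z : Fin n → ℂ} (hz : z ∈ Ω) :
    realTensor K μ ν z = (polarRealTensor K μ ν (z, star z)).re := by
  rw [realTensor_eq_bilin, bergmanBilin, LinearMap.mk₂_apply, LinearMap.mk₂_apply,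
    ← Complex.add_re, ← Complex.div_ofNat_re, polarRealTensor, ← Finset.sum_add_distrib,
    Finset.sum_div]
  congr 1
  refine Finset.sum_congr rfl fun a _ => ?_
  rw [← Finset.sum_add_distrib, Finset.sum_div]
  refine Finset.sum_congr rfl fun b _ => ?_
  rw [h.bergmanTensor_eq hΩ hpos a b hz]
  ring

theorem IsBergmanKernel.differentiableOn_polarRealTensor (hΩ : IsOpen Ω)
    (h : IsBergmanKernel Ω K) (μ ν : Fin (2 * n)) :
    DifferentiableOn ℂ (polarRealTensor K μ ν) (logDomain Ω K) := by
  have hW := h.isOpen_logDomain hΩ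
  have hL := h.differentiableOn_logKernel hΩ
  exact DifferentiableOn.fun_sum fun a _ => DifferentiableOn.fun_sum fun b _ =>
    ((hL.differentiableOn_fderiv_apply hW _).differentiableOn_fderiv_apply hW _).const_mul _

theorem IsBergmanKernel.fderiv_realTensor (hΩ : IsOpen Ω) (h : IsBergmanKernel Ω K)
    (hpos : DiagPos Ω K) (μ ν : Fin (2 * n)) {z : Fin n → ℂ} (hz : z ∈ Ω) (v : Fin n → ℂ) :
    fderiv ℝ (realTensor K μ ν) z v =
      (fderiv ℂ (polarRealTensor K μ ν) (z, star z) (v, star v)).re := by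
  have hev : realTensor K μ ν =ᶠ[𝓝 z]
      fun u => Complex.reCLM (polarRealTensor K μ ν (u, star u)) := by
    filter_upwards [hΩ.mem_nhds hz] with u hu
    exact h.realTensor_eq hΩ hpos μ ν hu
  have hd := hasFDerivAt_comp_star ((h.differentiableOn_polarRealTensor hΩ μ ν).differentiableAt
    ((h.isOpen_logDomain hΩ).mem_nhds (hpos.mem_logDomain hz)))
  have hcomp : HasFDerivAt (fun u => Complex.reCLM (polarRealTensor K μ ν (u, star u))) _ z :=
    Complex.reCLM.hasFDerivAt.comp z hd
  rw [hev.fderiv_eq, hcomp.fderiv]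
  rfl

theorem realDir_apply_re (μ : Fin (2 * n)) (a : Fin n) :
    (realDir μ a).re = if μ = ⟨2 * a, by omega⟩ then 1 else 0 := by
  simp only [realDir, Pi.single_apply, Fin.ext_iff]
  split_ifs <;> first | omega | simp

theorem realDir_apply_im (μ : Fin (2 * n)) (a : Fin n) :
    (realDir μ a).im = if μ = ⟨2 * a + 1, by omega⟩ then 1 else 0 := by
  simp only [realDir, Pi.single_apply, Fin.ext_iff]
  split_ifs <;> first | omega | simp

theorem eq_zero_of_sum_smul_realDir_eq_zero {y : Fin (2 * n) → ℝ}
    (hy : ∑ μ, y μ • realDir (n := n) μ = 0) : y = 0 := by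
  funext μ
  have ha : (μ : ℕ) / 2 < n := by omega
  have h1 := congrFun hy ⟨(μ : ℕ) / 2, ha⟩
  rw [Finset.sum_apply] at h1
  have hre := congrArg Complex.re h1
  have him := congrArg Complex.im h1
  simp only [Complex.re_sum, Complex.im_sum, Pi.smul_apply, Complex.smul_re, Complex.smul_im,
    realDir_apply_re, realDir_apply_im, smul_eq_mul, mul_ite, mul_one, mul_zero,
    Finset.sum_ite_eq', Finset.mem_univ, if_true, Pi.zero_apply, Complex.zero_re,
    Complex.zero_im] at hre him
  rcases Nat.mod_two_eq_zero_or_one μ with h | h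
  · have : (⟨2 * ((μ : ℕ) / 2), by omega⟩ : Fin (2 * n)) = μ := Fin.ext (by simp only; omega)
    rwa [this] at hre
  · have : (⟨2 * ((μ : ℕ) / 2) + 1, by omega⟩ : Fin (2 * n)) = μ := Fin.ext (by simp only; omega)
    rwa [this] at him

theorem BergPosDef.det_realTensor_ne_zero (h : BergPosDef Ω K) {z : Fin n → ℂ} (hz : z ∈ Ω) :
    (Matrix.of fun a b => realTensor K a b z).det ≠ 0 := by
  intro hdet
  obtain ⟨y, hy0, hy⟩ := Matrix.exists_mulVec_eq_zero_iff.2 hdet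
  set ξ : Fin n → ℂ := ∑ μ, y μ • realDir μ with hξ
  have hξ0 : ξ ≠ 0 := fun h0 => hy0 (eq_zero_of_sum_smul_realDir_eq_zero h0)
  have hpos : 0 < bergmanQuad K z ξ := Real.sqrt_pos.1 (h z hz ξ hξ0)
  have hB : bergmanBilin K z ξ ξ =
      ∑ μ, ∑ ν, y μ * y ν * bergmanBilin K z (realDir μ) (realDir ν) := by
    simp only [hξ, map_sum, LinearMap.sum_apply, map_smul, LinearMap.smul_apply, smul_eq_mul,
      Finset.mul_sum]
    rw [Finset.sum_comm]
    exact Finset.sum_congr rfl fun μ _ => Finset.sum_congr rfl fun ν _ => by ring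
  have hsum : ∑ μ, y μ * ∑ ν, realTensor K μ ν z * y ν = bergmanQuad K z ξ := by
    have hB' := hB
    rw [Finset.sum_comm] at hB'
    have hadd := congrArg₂ (· + ·) hB hB'
    simp only [← Finset.sum_add_distrib] at hadd
    have h2 : bergmanQuad K z ξ = (bergmanBilin K z ξ ξ + bergmanBilin K z ξ ξ) / 2 := by
      rw [bergmanQuad_eq_bilin]
      ring
    rw [h2, hadd, Finset.sum_div]
    refine Finset.sum_congr rfl fun μ _ => ?_
    rw [Finset.mul_sum, Finset.sum_div]
    refine Finset.sum_congr rfl fun ν _ => ?_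
    rw [realTensor_eq_bilin]
    ring
  have hzero : ∀ μ, ∑ ν, realTensor K μ ν z * y ν = 0 := fun μ => congrFun hy μ
  simp only [hzero, mul_zero, Finset.sum_const_zero] at hsum
  exact hpos.ne hsum

variable {Ωj : ℕ → Set (Fin n → ℂ)} {Kj : ℕ → (Fin n → ℂ) → (Fin n → ℂ) → ℂ}

theorem holConv_polarRealTensor (hΩ : IsOpen Ω) (hK : IsBergmanKernel Ω K)
    (hconv : HolConv atTop (fun j (q : (Fin n → ℂ) × (Fin n → ℂ)) => Kj j q.1 (star q.2))
      (fun q => K q.1 (star q.2)) {p | p.1 ∈ Ω ∧ star p.2 ∈ Ω}) (μ ν : Fin (2 * n)) :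
    HolConv atTop (fun j => polarRealTensor (Kj j) μ ν) (polarRealTensor K μ ν)
      (logDomain Ω K) := by
  have hW := hK.isOpen_logDomain hΩ
  have hlog : HolConv atTop (fun j => logKernel (Kj j)) (logKernel K) (logDomain Ω K) :=
    (hconv.mono inter_subset_left).clog fun p hp => hp.2
  exact HolConv.sum fun a _ => HolConv.sum fun b _ =>
    ((hlog.fderiv_apply hW _).fderiv_apply hW _).const_mul _

theorem tendsto_prod_star (z : Fin n → ℂ) :
    Tendsto (fun p : ℕ × (Fin n → ℂ) => (p.1, (p.2, star p.2))) (atTop ×ˢ 𝓝 z)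
      (atTop ×ˢ 𝓝 (z, star z)) :=
  tendsto_fst.prodMk ((Continuous.tendsto (f := fun x : Fin n → ℂ => (x, star x))
    (by fun_prop) z).comp tendsto_snd)

theorem tendsto_matrix_inv_apply {α m : Type*} [Fintype m] [DecidableEq m] {l : Filter α}
    {A : α → Matrix m m ℝ} {B : Matrix m m ℝ} (h : Tendsto A l (𝓝 B)) (hB : B.det ≠ 0)
    (i j : m) : Tendsto (fun x => (A x)⁻¹ i j) l (𝓝 (B⁻¹ i j)) := by
  have hdet : Tendsto (fun x => (A x).det) l (𝓝 B.det) :=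
    ((continuous_id.matrix_det).tendsto B).comp h
  have hadj : Tendsto (fun x => (A x).adjugate i j) l (𝓝 (B.adjugate i j)) :=
    (((continuous_id.matrix_adjugate).matrix_elem i j).tendsto B).comp h
  simp only [Matrix.inv_def, Ring.inverse_eq_inv', Matrix.smul_apply, smul_eq_mul]
  exact (hdet.inv₀ hB).mul hadj

/-- The Christoffel symbols converge continuously. -/
theorem tendsto_christoffel (hopen : ∀ j, IsOpen (Ωj j)) (hopenl : IsOpen Ω)
    (hsub : ∀ S : Set (Fin n → ℂ), IsCompact S → S ⊆ Ω → ∀ᶠ j in atTop, S ⊆ Ωj j)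
    (hKj : ∀ j, IsBergmanKernel (Ωj j) (Kj j)) (hK : IsBergmanKernel Ω K)
    (hKjpos : ∀ j, DiagPos (Ωj j) (Kj j)) (hKpos : DiagPos Ω K)
    (hdiag : ∀ z ∈ Ω, Tendsto (fun j => Kj j z z) atTop (𝓝 (K z z)))
    (hposdef : BergPosDef Ω K) (η μ ν : Fin (2 * n)) {z : Fin n → ℂ} (hz : z ∈ Ω) :
    Tendsto (fun p : ℕ × (Fin n → ℂ) => christoffel (Kj p.1) η μ ν p.2) (atTop ×ˢ 𝓝 z)
      (𝓝 (christoffel K η μ ν z)) := by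
  have hW := hK.isOpen_logDomain hopenl
  have hconv := holConv_bergmanKernel hopen hopenl hsub hKj hK hdiag
  have hev : ∀ᶠ p in (atTop : Filter ℕ) ×ˢ 𝓝 z, p.2 ∈ Ωj p.1 := by
    obtain ⟨r, hr, hrΩ⟩ := (nhds_basis_closedBall.mem_iff).1 (hopenl.mem_nhds hz)
    refine eventually_prod_nhds_of_ball (P := fun j z => z ∈ Ωj j) hr ?_
    filter_upwards [hsub _ (isCompact_closedBall _ _) hrΩ] with j hj x hx
    exact hj (ball_subset_closedBall hx)
  have hmem := hKpos.mem_logDomain hz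
  have htensor : ∀ a b : Fin (2 * n), Tendsto
      (fun p : ℕ × (Fin n → ℂ) => realTensor (Kj p.1) a b p.2) (atTop ×ˢ 𝓝 z)
      (𝓝 (realTensor K a b z)) := by
    intro a b
    rw [hK.realTensor_eq hopenl hKpos a b hz]
    have h1 := (Complex.continuous_re.tendsto _).comp
      (((holConv_polarRealTensor hopenl hK hconv a b).tendsto _ hmem).comp (tendsto_prod_star z))
    refine h1.congr' ?_
    filter_upwards [hev] with p hp
    exact ((hKj p.1).realTensor_eq (hopen p.1) (hKjpos p.1) a b hp).symm
  have hderiv : ∀ (a b : Fin (2 * n)) (v : Fin n → ℂ), Tendsto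
      (fun p : ℕ × (Fin n → ℂ) => fderiv ℝ (realTensor (Kj p.1) a b) p.2 v) (atTop ×ˢ 𝓝 z)
      (𝓝 (fderiv ℝ (realTensor K a b) z v)) := by
    intro a b v
    rw [hK.fderiv_realTensor hopenl hKpos a b hz]
    have h1 := (Complex.continuous_re.tendsto _).comp
      ((((holConv_polarRealTensor hopenl hK hconv a b).fderiv_apply hW (v, star v)).tendsto _
        hmem).comp (tendsto_prod_star z))
    refine h1.congr' ?_
    filter_upwards [hev] with p hp
    exact ((hKj p.1).fderiv_realTensor (hopen p.1) (hKjpos p.1) a b hp v).symm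
  have hmat : Tendsto (fun p : ℕ × (Fin n → ℂ) => Matrix.of fun a b => realTensor (Kj p.1) a b p.2)
      (atTop ×ˢ 𝓝 z) (𝓝 (Matrix.of fun a b => realTensor K a b z)) :=
    tendsto_pi_nhds.2 fun a => tendsto_pi_nhds.2 fun b => htensor a b
  refine Tendsto.const_mul _ (tendsto_finsetSum _ fun τ _ => Tendsto.mul ?_ ?_)
  · exact ((hderiv _ _ _).add (hderiv _ _ _)).sub (hderiv _ _ _)
  · exact tendsto_matrix_inv_apply hmat (hposdef.det_realTensor_ne_zero hz) _ _

theorem continuousOn_christoffel (hΩ : IsOpen Ω) (hK : IsBergmanKernel Ω K) (hpos : DiagPos Ω K)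
    (hposdef : BergPosDef Ω K) (η μ ν : Fin (2 * n)) :
    ContinuousOn (christoffel K η μ ν) Ω := by
  intro z hz
  refine ContinuousAt.continuousWithinAt ?_
  have h := tendsto_christoffel (Ωj := fun _ => Ω) (Kj := fun _ => K) (fun _ => hΩ) hΩ
    (fun S _ hS => .of_forall fun _ => hS) (fun _ => hK) hK (fun _ => hpos) hpos
    (fun z _ => tendsto_const_nhds) hposdef η μ ν hz
  have hsnd : Tendsto (christoffel K η μ ν ∘ Prod.snd) ((atTop : Filter ℕ) ×ˢ 𝓝 z)
    (𝓝 (christoffel K η μ ν z)) := h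
  rwa [← tendsto_map'_iff, map_snd_prod] at hsnd

end BergmanTensor

/-- stability of the Christoffel symbols of the Bergman metric for a
sequence of domains converging in the local Hausdorff sense. -/
theorem christoffel_stability {n : ℕ} (Ω : ℕ → Set (Fin n → ℂ)) (Ωl : Set (Fin n → ℂ))
    (hopen : ∀ j, IsOpen (Ω j)) (hopenl : IsOpen Ωl)
    (hconv : LocalHausdorffConv Ω Ωl)
    (Kj : ℕ → (Fin n → ℂ) → (Fin n → ℂ) → ℂ) (hKj : ∀ j, IsBergmanKernel (Ω j) (Kj j))
    (Kl : (Fin n → ℂ) → (Fin n → ℂ) → ℂ) (hKl : IsBergmanKernel Ωl Kl)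
    (hKjpos : ∀ j, DiagPos (Ω j) (Kj j)) (hKlpos : DiagPos Ωl Kl)
    (hdiag : ∀ z ∈ Ωl, Filter.Tendsto (fun j => Kj j z z) Filter.atTop (nhds (Kl z z)))
    (hjposdef : ∀ j, BergPosDef (Ω j) (Kj j)) (hposdef : BergPosDef Ωl Kl) :
    ∀ η μ ν : Fin (2 * n),
      TendstoLocallyUniformlyOn (fun j => christoffel (Kj j) η μ ν)
        (christoffel Kl η μ ν) Filter.atTop Ωl := by
  intro η μ ν
  exact tendstoLocallyUniformlyOn_of_tendsto_prod hopenl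
    (fun z hz => tendsto_christoffel hopen hopenl hconv.1 hKj hKl hKjpos hKlpos hdiag hposdef
      η μ ν hz)
    (continuousOn_christoffel hopenl hKl hKlpos hposdef η μ ν)

end
end
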